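/- arXiv:1704.07200 — 2 statements merged into one kernel-verified Lean document; each statement's English description precedes it below -/
import Mathlib

section
/- Every properly edge-coloured complete graph K_n contains at least n/10^12 pairwise edge-disjoint rainbow spanning trees (a rainbow tree is a tree whose edges all have distinct colours). -/
open scoped Classical

/-- A colouring of edges is proper if edges sharing a vertex get distinct colours. -/
def ProperColoring {V : Type*} (G : SimpleGraph V) (c : Sym2 V → ℕ) : Prop :=
  ∀ ⦃a b b' : V⦄, G.Adj a b → G.Adj a b' → b ≠ b' → c s(a, b) ≠ c s(a, b')

/-- A set of edges is rainbow if its edges have pairwise distinct colours. -/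
def IsRainbow {V : Type*} (c : Sym2 V → ℕ) (E : Set (Sym2 V)) : Prop :=
  Set.InjOn c E

/-- A finite set of edges forms a matching: non-loops, pairwise vertex-disjoint. -/
def IsMatchingSet {V : Type*} (M : Finset (Sym2 V)) : Prop :=
  (∀ e ∈ M, ¬ e.IsDiag) ∧
  ∀ e ∈ M, ∀ f ∈ M, e ≠ f → ∀ v : V, v ∈ e → v ∉ f

/-- A class `U` of colours is `α`-rich in `G`: the edges of `G` with colour in `U`
contain a matching of size at least `α * |V|`. -/
def RichClass {V : Type*} [Fintype V] (G : SimpleGraph V) (c : Sym2 V → ℕ)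
    (α : ℝ) (U : Set ℕ) : Prop :=
  ∃ M : Finset (Sym2 V), ↑M ⊆ G.edgeSet ∧ (∀ e ∈ M, c e ∈ U) ∧
    IsMatchingSet M ∧ α * (Fintype.card V : ℝ) ≤ (M.card : ℝ)

/-- `G` is `α`-well-coloured: its colours can be partitioned into `|V| - 1`
pairwise disjoint `α`-rich classes. -/
def WellColoured {V : Type*} [Fintype V] (G : SimpleGraph V) (c : Sym2 V → ℕ)
    (α : ℝ) : Prop :=
  ∃ U : Fin (Fintype.card V - 1) → Set ℕ,
    (∀ i j, i ≠ j → Disjoint (U i) (U j)) ∧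
    (∀ i, RichClass G c α (U i)) ∧
    (∀ e ∈ G.edgeSet, ∃ i, c e ∈ U i)

/-- A rainbow forest in `G`. -/
def RainbowForest {V : Type*} (G : SimpleGraph V) (c : Sym2 V → ℕ)
    (F : SimpleGraph V) : Prop :=
  F ≤ G ∧ F.IsAcyclic ∧ IsRainbow c F.edgeSet

/-- `G` is `(α, t)`-robustly-coloured: after removing the edges of any `t`
rainbow forests, `G` remains `α`-well-coloured. -/
def RobustlyColoured {V : Type*} [Fintype V] (G : SimpleGraph V) (c : Sym2 V → ℕ)
    (α : ℝ) (t : ℕ) : Prop :=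
  ∀ F : Fin t → SimpleGraph V, (∀ i, RainbowForest G c (F i)) →
    WellColoured (G.deleteEdges (⋃ i, (F i).edgeSet)) c α

namespace RainbowTrees

open Finset SimpleGraph

set_option linter.unusedSectionVars false

variable {V : Type*} [Fintype V]

/-- The degree of a vertex, as a cardinality of a set. -/
noncomputable def deg (F : SimpleGraph V) (v : V) : ℕ := (F.neighborSet v).ncard

/-- The number of edges of a graph. -/
noncomputable def size (F : SimpleGraph V) : ℕ := F.edgeSet.ncard

/-- The ordered pairs of distinct vertices whose edge has colour `γ`. -/
noncomputable def colourPairs (c : Sym2 V → ℕ) (γ : ℕ) : Finset (V × V) :=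
  univ.filter fun p => p.1 ≠ p.2 ∧ c s(p.1, p.2) = γ

theorem mem_colourPairs {c : Sym2 V → ℕ} {γ : ℕ} {p : V × V} :
    p ∈ colourPairs c γ ↔ p.1 ≠ p.2 ∧ c s(p.1, p.2) = γ := by
  simp [colourPairs]

theorem size_eq_card (F : SimpleGraph V) : size F = F.edgeFinset.card := by
  rw [size, Set.ncard_eq_toFinset_card']; rfl

theorem deg_eq_degree (F : SimpleGraph V) (v : V) : deg F v = F.degree v := by
  rw [deg, Set.ncard_eq_toFinset_card']; rfl

theorem sum_deg (F : SimpleGraph V) : ∑ v, deg F v = 2 * size F := by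
  rw [size_eq_card, ← sum_degrees_eq_twice_card_edges]
  exact sum_congr rfl fun v _ => deg_eq_degree F v

theorem card_high_degree_mul_le (F : SimpleGraph V) (d : ℕ) :
    (univ.filter fun v => d ≤ deg F v).card * d ≤ 2 * size F := by
  rw [← sum_deg, ← smul_eq_mul]
  calc _ ≤ ∑ v ∈ univ.filter (fun v => d ≤ deg F v), deg F v :=
        card_nsmul_le_sum _ _ _ fun v hv => (mem_filter.1 hv).2
    _ ≤ _ := sum_le_sum_of_subset (filter_subset _ _)

theorem card_adj_pairs (F : SimpleGraph V) :
    (univ.filter fun p : V × V => F.Adj p.1 p.2).card = 2 * size F := by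
  rw [size_eq_card, two_mul_card_edgeFinset]

/-- The number of vertices covered by a set of edges is at most twice its size. -/
theorem card_covered_le (E : Finset (Sym2 V)) :
    (univ.filter fun v : V => ∃ e ∈ E, v ∈ e).card ≤ 2 * E.card := by
  have : (univ.filter fun v : V => ∃ e ∈ E, v ∈ e) ⊆ E.biUnion fun e => e.toFinset := by
    intro v hv
    simpa using hv
  refine (card_le_card this).trans ?_
  rw [mul_comm]
  refine card_biUnion_le_card_mul _ _ _ fun e _ => ?_
  by_cases h : e.IsDiag
  · rw [Sym2.card_toFinset_of_isDiag e h]; omega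
  · rw [Sym2.card_toFinset_of_not_isDiag e h]

theorem deg_sup_edge_le (F : SimpleGraph V) (x y v : V) :
    deg (F ⊔ edge x y) v ≤ deg F v + 1 := by
  by_cases hv : v = x
  · refine (Set.ncard_le_ncard (t := insert y (F.neighborSet v)) ?_).trans (Set.ncard_insert_le _ _)
    intro w hw
    simp only [mem_neighborSet, sup_adj, edge_adj] at hw
    simp only [Set.mem_insert_iff, mem_neighborSet]
    subst hv
    tauto
  · refine (Set.ncard_le_ncard (t := insert x (F.neighborSet v)) ?_).trans (Set.ncard_insert_le _ _)
    intro w hw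
    simp only [mem_neighborSet, sup_adj, edge_adj] at hw
    simp only [Set.mem_insert_iff, mem_neighborSet]
    tauto

theorem deg_sup_edge_of_ne (F : SimpleGraph V) {x y v : V} (hx : v ≠ x) (hy : v ≠ y) :
    deg (F ⊔ edge x y) v = deg F v := by
  unfold deg
  congr 1
  ext w
  simp [edge_adj, hx, hy]

theorem deg_mono {F G : SimpleGraph V} (h : F ≤ G) (v : V) : deg F v ≤ deg G v :=
  Set.ncard_le_ncard fun _ hw => h hw

theorem size_mono {F G : SimpleGraph V} (h : F ≤ G) : size F ≤ size G :=
  Set.ncard_le_ncard (edgeSet_mono h)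

theorem edgeSet_sup_edge (F : SimpleGraph V) {x y : V} (h : x ≠ y) :
    (F ⊔ edge x y).edgeSet = insert s(x, y) F.edgeSet := by
  rw [edgeSet_sup, edgeSet_edge_of_ne h, Set.union_comm, Set.singleton_union]

theorem size_sup_edge (F : SimpleGraph V) {x y : V} (h : x ≠ y) (hF : ¬F.Adj x y) :
    size (F ⊔ edge x y) = size F + 1 := by
  rw [size, edgeSet_sup_edge F h, Set.ncard_insert_of_notMem (by simpa using hF), size]

theorem size_deleteEdges (F : SimpleGraph V) {e : Sym2 V} (h : e ∈ F.edgeSet) :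
    size (F.deleteEdges {e}) + 1 = size F := by
  rw [size, edgeSet_deleteEdges, Set.ncard_sdiff_singleton_add_one h, size]

theorem size_add_one_le (F : SimpleGraph V) [Nonempty V] (hF : F.IsAcyclic) :
    size F + 1 ≤ Fintype.card V := by
  obtain ⟨T, hT, -, hTt⟩ := connected_top.exists_isTree_le_of_le_of_isAcyclic le_top hF
  rw [← hTt.card_edgeFinset, ← size_eq_card]
  exact Nat.add_le_add_right (size_mono hT) 1

theorem size_add_two_le (F : SimpleGraph V) (hF : F.IsAcyclic) {x y : V} (h : ¬F.Reachable x y) :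
    size F + 2 ≤ Fintype.card V := by
  have hxy : x ≠ y := by rintro rfl; exact h .rfl
  have : Nonempty V := ⟨x⟩
  have := size_add_one_le _ (hF.sup_edge_of_not_reachable h)
  rw [size_sup_edge F hxy fun h' => h h'.reachable] at this
  exact this

/-- In a forest, the first edge of the path between two vertices separates them. -/
theorem exists_adj_separating {F : SimpleGraph V} (hF : F.IsAcyclic) {a b : V} (hab : a ≠ b)
    (h : F.Reachable a b) :
    ∃ a', F.Adj a a' ∧ ¬(F.deleteEdges {s(a, a')}).Reachable a b := by
  obtain ⟨p, hp⟩ := h.exists_isPath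
  cases p with
  | nil => exact absurd rfl hab
  | @cons _ a' _ hadj q =>
    refine ⟨a', hadj, fun hr => ?_⟩
    rw [Walk.cons_isPath_iff] at hp
    have hbr := isAcyclic_iff_forall_adj_isBridge.1 hF hadj
    rw [isBridge_iff] at hbr
    refine hbr (hr.trans ?_)
    refine (q.toDeleteEdge s(a, a') fun he => hp.2 ?_).reachable.symm
    exact q.fst_mem_support_of_mem_edges he

/-- Deleting an edge `uv` leaves every vertex of its component joined to `u` or to `v`. -/
theorem reachable_deleteEdges_or {F : SimpleGraph V} {u v w : V} (h : F.Reachable w u) :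
    (F.deleteEdges {s(u, v)}).Reachable w u ∨ (F.deleteEdges {s(u, v)}).Reachable w v := by
  obtain ⟨p⟩ := h
  induction p with
  | nil => exact Or.inl .rfl
  | @cons x y z hadj q ih =>
    by_cases he : s(x, y) = s(z, v)
    · rw [Sym2.eq_iff] at he
      rcases he with ⟨rfl, rfl⟩ | ⟨rfl, rfl⟩
      · exact Or.inl .rfl
      · exact Or.inr .rfl
    · have : (F.deleteEdges {s(z, v)}).Adj x y := by simp [deleteEdges_adj, hadj, he]
      exact ih.imp this.reachable.trans this.reachable.trans

/-- Exchanging an edge for one that reconnects the two sides preserves reachability. -/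
theorem reachable_exchange {F : SimpleGraph V} {u v a b w z : V} (huv : F.Adj u v)
    (hau : F.Reachable a u) (hbu : F.Reachable b u)
    (hab : ¬(F.deleteEdges {s(u, v)}).Reachable a b) (h : F.Reachable w z) :
    (F.deleteEdges {s(u, v)} ⊔ edge a b).Reachable w z := by
  set F₀ := F.deleteEdges {s(u, v)} with hF₀
  have hle : F₀ ≤ F₀ ⊔ edge a b := le_sup_left
  have hne : a ≠ b := by rintro rfl; exact hab .rfl
  have hedge : (F₀ ⊔ edge a b).Reachable a b := by
    refine Adj.reachable ?_
    simp [edge_adj, hne]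
  have huv' : (F₀ ⊔ edge a b).Reachable u v := by
    rcases reachable_deleteEdges_or (v := v) hau with ha | ha <;>
      rcases reachable_deleteEdges_or (v := v) hbu with hb | hb
    · exact absurd (ha.trans hb.symm) hab
    · exact ((ha.mono hle).symm.trans hedge).trans (hb.mono hle)
    · exact ((hb.mono hle).symm.trans hedge.symm).trans (ha.mono hle)
    · exact absurd (ha.trans hb.symm) hab
  obtain ⟨p⟩ := h
  induction p with
  | nil => exact .rfl
  | @cons x y z hadj q ih =>
    refine Reachable.trans ?_ ih
    by_cases he : s(x, y) = s(u, v)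
    · rw [Sym2.eq_iff] at he
      rcases he with ⟨rfl, rfl⟩ | ⟨rfl, rfl⟩
      · exact huv'
      · exact huv'.symm
    · refine Adj.reachable (hle ?_)
      simp [hF₀, deleteEdges_adj, hadj, he]

theorem card_colourPairs_fst_le {c : Sym2 V → ℕ} (hc : ProperColoring (⊤ : SimpleGraph V) c)
    (γ : ℕ) (X : Finset V) : ((colourPairs c γ).filter fun p => p.1 ∈ X).card ≤ X.card := by
  refine card_le_card_of_injOn Prod.fst (fun p hp => (mem_filter.1 hp).2) ?_
  rintro ⟨a, b⟩ hp ⟨a', b'⟩ hq (rfl : a = a')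
  simp only [coe_filter, Set.mem_ofPred_eq, mem_colourPairs] at hp hq
  by_contra hne
  exact hc (by simpa using hp.1.1) (by simpa using hq.1.1) (fun h => hne (by rw [h]))
    (hp.1.2.trans hq.1.2.symm)

theorem card_colourPairs_snd_le {c : Sym2 V → ℕ} (hc : ProperColoring (⊤ : SimpleGraph V) c)
    (γ : ℕ) (X : Finset V) : ((colourPairs c γ).filter fun p => p.2 ∈ X).card ≤ X.card := by
  refine le_trans (le_of_eq ?_) (card_colourPairs_fst_le hc γ X)
  refine card_bij' (fun p _ => p.swap) (fun p _ => p.swap) ?_ ?_ (by simp) (by simp)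
  all_goals
    rintro ⟨a, b⟩ hp
    simp only [mem_filter, mem_colourPairs, Prod.swap] at hp ⊢
    exact ⟨⟨hp.1.1.symm, by rw [Sym2.eq_swap]; exact hp.1.2⟩, hp.2⟩

theorem card_colourPairs_le {c : Sym2 V → ℕ} (hc : ProperColoring (⊤ : SimpleGraph V) c)
    (γ : ℕ) : (colourPairs c γ).card ≤ Fintype.card V := by
  simpa using card_colourPairs_fst_le hc γ univ

theorem isRainbow_sup_edge {c : Sym2 V → ℕ} {F : SimpleGraph V} {x y : V}
    (hF : IsRainbow c F.edgeSet) (h : ∀ e ∈ F.edgeSet, c e ≠ c s(x, y)) :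
    IsRainbow c (F ⊔ edge x y).edgeSet := by
  by_cases hxy : x = y
  · subst hxy
    simpa using hF
  · rw [edgeSet_sup_edge F hxy, IsRainbow, Set.injOn_insert fun he => h _ he rfl]
    exact ⟨hF, fun ⟨e, he, hce⟩ => h e he hce⟩

/-- The vertices reachable from `r`. -/
noncomputable def component (F : SimpleGraph V) (r : V) : Finset V :=
  univ.filter fun w => F.Reachable r w

theorem mem_component {F : SimpleGraph V} {r w : V} : w ∈ component F r ↔ F.Reachable r w := by
  simp [component]

/-- A rainbow forest containing `S` and avoiding `H`, all of whose edges outside `S` lie in the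
component of the root `r`. -/
structure PartialTree (c : Sym2 V → ℕ) (H S : SimpleGraph V) (σ D : ℕ) (r : V)
    (F : SimpleGraph V) : Prop where
  le : S ≤ F
  acyclic : F.IsAcyclic
  rainbow : IsRainbow c F.edgeSet
  avoids : ∀ u v, F.Adj u v → ¬H.Adj u v
  deg_le : ∀ v, deg F v ≤ D
  reach : ∀ u v, F.Adj u v → ¬S.Adj u v → F.Reachable r u
  size_le : size F + 1 ≤ (component F r).card + σ

theorem PartialTree.deg_le_of_not_reachable {c : Sym2 V → ℕ} {H S F : SimpleGraph V} {σ D : ℕ}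
    {r y : V} (hF : PartialTree c H S σ D r F) (hy : ¬F.Reachable r y) : deg F y ≤ deg S y := by
  refine Set.ncard_le_ncard fun w hw => ?_
  by_contra hS
  exact hy (hF.reach y w hw hS)

/-- Extending the component of the root by an edge of an unused colour. -/
theorem PartialTree.extend {c : Sym2 V → ℕ} {H S F : SimpleGraph V} {σ D : ℕ} {r x y : V}
    (hF : PartialTree c H S σ D r F) (hx : F.Reachable r x) (hy : ¬F.Reachable r y)
    (hH : ¬H.Adj x y) (hdx : deg F x + 1 ≤ D) (hdy : deg S y + 1 ≤ D)
    (hc : ∀ e ∈ F.edgeSet, c e ≠ c s(x, y)) :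
    PartialTree c H S σ D r (F ⊔ edge x y) ∧ (F ⊔ edge x y).Reachable r y ∧
      deg (F ⊔ edge x y) y ≤ deg S y + 1 ∧ size (F ⊔ edge x y) = size F + 1 := by
  have hle : F ≤ F ⊔ edge x y := le_sup_left
  have hxy : x ≠ y := by rintro rfl; exact hy hx
  have hnr : ¬F.Reachable x y := fun h => hy (hx.trans h)
  have hnadj : ¬F.Adj x y := fun h => hnr h.reachable
  have hry : (F ⊔ edge x y).Reachable r y :=
    (hx.mono hle).trans (Adj.reachable (by simp [edge_adj, hxy]))
  have hFy := hF.deg_le_of_not_reachable hy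
  have hsize := size_sup_edge F hxy hnadj
  refine ⟨⟨hF.le.trans hle, hF.acyclic.sup_edge_of_not_reachable hnr,
    isRainbow_sup_edge hF.rainbow hc, ?_, ?_, ?_, ?_⟩, hry, ?_, hsize⟩
  · intro u v huv
    rw [sup_adj, edge_adj] at huv
    rcases huv with huv | ⟨⟨rfl, rfl⟩ | ⟨rfl, rfl⟩, -⟩
    · exact hF.avoids u v huv
    · exact hH
    · exact fun h => hH h.symm
  · intro v
    by_cases hvx : v = x
    · subst hvx
      exact (deg_sup_edge_le F v y v).trans hdx
    by_cases hvy : v = y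
    · subst hvy
      exact (deg_sup_edge_le F x v v).trans (by omega)
    · rw [deg_sup_edge_of_ne F hvx hvy]
      exact hF.deg_le v
  · intro u v huv hS
    rw [sup_adj, edge_adj] at huv
    rcases huv with huv | ⟨⟨rfl, rfl⟩ | ⟨rfl, rfl⟩, -⟩
    · exact (hF.reach u v huv hS).mono hle
    · exact hx.mono hle
    · exact hry
  · rw [hsize]
    have hlt : (component F r).card <
        (component (F ⊔ edge x y) r).card := by
      refine card_lt_card ((ssubset_iff_of_subset ?_).2 ⟨y, mem_component.2 hry,
        fun h => hy (mem_component.1 h)⟩)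
      intro w hw
      exact mem_component.2 ((mem_component.1 hw).mono hle)
    have := hF.size_le
    omega
  · exact (deg_sup_edge_le F x y y).trans (by omega)

theorem reachable_of_exchange {F : SimpleGraph V} {s : Set (Sym2 V)} {a b w z : V}
    (hab : F.Reachable a b) (h : (F.deleteEdges s ⊔ edge a b).Reachable w z) :
    F.Reachable w z := by
  obtain ⟨p⟩ := h
  induction p with
  | nil => exact .rfl
  | @cons x y z hadj q ih =>
    refine Reachable.trans ?_ ih
    rw [sup_adj, edge_adj, deleteEdges_adj] at hadj
    rcases hadj with ⟨h, -⟩ | ⟨⟨rfl, rfl⟩ | ⟨rfl, rfl⟩, -⟩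
    · exact h.reachable
    · exact hab
    · exact hab.symm

/-- Exchanging an edge outside `S` for an edge of an unused colour reconnecting the two sides. -/
theorem PartialTree.exchange {c : Sym2 V → ℕ} {H S F : SimpleGraph V} {σ D : ℕ} {r a b u v : V}
    (hF : PartialTree c H S σ D r F) (ha : F.Reachable r a) (hb : F.Reachable r b)
    (hH : ¬H.Adj a b) (hda : deg F a + 1 ≤ D) (hdb : deg F b + 1 ≤ D)
    (hc : ∀ e ∈ F.edgeSet, c e ≠ c s(a, b)) (huv : F.Adj u v) (hS : ¬S.Adj u v)
    (hab : ¬(F.deleteEdges {s(u, v)}).Reachable a b) :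
    PartialTree c H S σ D r (F.deleteEdges {s(u, v)} ⊔ edge a b) ∧
      (∀ w, (F.deleteEdges {s(u, v)} ⊔ edge a b).Reachable r w ↔ F.Reachable r w) ∧
      size (F.deleteEdges {s(u, v)} ⊔ edge a b) = size F ∧
      ∀ e ∈ (F.deleteEdges {s(u, v)} ⊔ edge a b).edgeSet, c e ≠ c s(u, v) := by
  have hne : a ≠ b := by rintro rfl; exact hab .rfl
  have hru : F.Reachable r u := hF.reach u v huv hS
  have hle : F.deleteEdges {s(u, v)} ≤ F := deleteEdges_le _
  have hreach : ∀ w, (F.deleteEdges {s(u, v)} ⊔ edge a b).Reachable r w ↔ F.Reachable r w :=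
    fun w => ⟨reachable_of_exchange (ha.symm.trans hb),
      reachable_exchange huv (ha.symm.trans hru) (hb.symm.trans hru) hab⟩
  have hsize : size (F.deleteEdges {s(u, v)} ⊔ edge a b) = size F := by
    rw [size_sup_edge _ hne fun h => hab h.reachable, size_deleteEdges F (by simpa using huv)]
  have hrain : IsRainbow c (F.deleteEdges {s(u, v)}).edgeSet :=
    Set.InjOn.mono (edgeSet_mono hle) hF.rainbow
  refine ⟨⟨?_, (hF.acyclic.anti hle).sup_edge_of_not_reachable hab,
    isRainbow_sup_edge hrain fun e he => hc e (edgeSet_mono hle he), ?_, ?_, ?_, ?_⟩,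
    hreach, hsize, ?_⟩
  · intro x y hxy
    refine Or.inl ?_
    rw [deleteEdges_adj]
    refine ⟨hF.le hxy, fun h => hS ?_⟩
    rw [Set.mem_singleton_iff] at h
    rw [← mem_edgeSet, ← h]
    exact hxy
  · intro x y hxy
    rw [sup_adj, edge_adj] at hxy
    rcases hxy with hxy | ⟨⟨rfl, rfl⟩ | ⟨rfl, rfl⟩, -⟩
    · exact hF.avoids x y (hle hxy)
    · exact hH
    · exact fun h => hH h.symm
  · intro w
    have hw := deg_mono hle w
    by_cases hwa : w = a
    · subst hwa
      exact (deg_sup_edge_le _ w b w).trans (by omega)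
    by_cases hwb : w = b
    · subst hwb
      exact (deg_sup_edge_le _ a w w).trans (by omega)
    · rw [deg_sup_edge_of_ne _ hwa hwb]
      exact hw.trans (hF.deg_le w)
  · intro x y hxy hSxy
    rw [hreach]
    rw [sup_adj, edge_adj] at hxy
    rcases hxy with hxy | ⟨⟨rfl, rfl⟩ | ⟨rfl, rfl⟩, -⟩
    · exact hF.reach x y (hle hxy) hSxy
    · exact ha
    · exact hb
  · rw [hsize]
    rw [show component _ r = component F r by ext w; rw [mem_component, mem_component, hreach]]
    exact hF.size_le
  · intro e he
    rw [edgeSet_sup_edge _ hne, edgeSet_deleteEdges] at he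
    rcases he with rfl | ⟨he, hne'⟩
    · exact fun h => hc s(u, v) huv h.symm
    · exact fun h => hne' (hF.rainbow he huv h)

/-- An exchange that frees the colour of an edge, followed by an extension using that colour. -/
theorem PartialTree.exchange_extend {c : Sym2 V → ℕ} {H S F : SimpleGraph V} {σ D : ℕ}
    {r a b u v x y : V} (hF : PartialTree c H S σ D r F) (ha : F.Reachable r a)
    (hb : F.Reachable r b) (hH : ¬H.Adj a b) (hda : deg F a + 1 ≤ D) (hdb : deg F b + 1 ≤ D)
    (hc : ∀ e ∈ F.edgeSet, c e ≠ c s(a, b)) (huv : F.Adj u v) (hS : ¬S.Adj u v)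
    (hab : ¬(F.deleteEdges {s(u, v)}).Reachable a b)
    (hx : F.Reachable r x) (hy : ¬F.Reachable r y) (hHxy : ¬H.Adj x y) (hdx : deg F x + 2 ≤ D)
    (hdy : deg S y + 1 ≤ D) (hcxy : c s(u, v) = c s(x, y)) :
    ∃ F' : SimpleGraph V, PartialTree c H S σ D r F' ∧ F'.Reachable r y ∧
      deg F' y ≤ deg S y + 1 ∧ size F' = size F + 1 := by
  obtain ⟨hF1, hr, hs, hc1⟩ := hF.exchange ha hb hH hda hdb hc huv hS hab
  have hd := deg_sup_edge_le (F.deleteEdges {s(u, v)}) a b x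
  have hd' := deg_mono (deleteEdges_le (G := F) {s(u, v)}) x
  obtain ⟨h1, h2, h3, h4⟩ := hF1.extend ((hr x).2 hx) (fun h => hy ((hr y).1 h)) hHxy (by omega) hdy
    (fun e he => hcxy ▸ hc1 e he)
  exact ⟨_, h1, h2, h3, by omega⟩

/-- The vertices whose degree is at least `D - 1`. -/
noncomputable def fullVertices (F : SimpleGraph V) (D : ℕ) : Finset V :=
  univ.filter fun v => D ≤ deg F v + 1

theorem mem_fullVertices {F : SimpleGraph V} {D : ℕ} {v : V} :
    v ∈ fullVertices F D ↔ D ≤ deg F v + 1 := by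
  simp [fullVertices]

/-- A partial tree is stuck if it cannot be enlarged by one edge while keeping a vertex of low
degree in the component of the root. -/
def IsStuck (c : Sym2 V → ℕ) (H S : SimpleGraph V) (σ D : ℕ) (r : V) (F : SimpleGraph V) : Prop :=
  ∀ (F' : SimpleGraph V) (y : V), PartialTree c H S σ D r F' → F'.Reachable r y →
    deg F' y ≤ deg S y + 1 → size F' ≠ size F + 1

theorem IsStuck.exists_colour {c : Sym2 V → ℕ} {H S F : SimpleGraph V} {σ D : ℕ} {r x y : V}
    (hst : IsStuck c H S σ D r F) (hF : PartialTree c H S σ D r F) (hS : ∀ v, deg S v + 1 ≤ D)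
    (hx : F.Reachable r x) (hy : ¬F.Reachable r y) (hH : ¬H.Adj x y) (hdx : deg F x + 1 ≤ D) :
    ∃ e ∈ F.edgeFinset, c e = c s(x, y) := by
  by_contra! hc
  obtain ⟨h1, h2, h3, h4⟩ := hF.extend hx hy hH hdx (hS y) fun e he => hc e (by simpa using he)
  exact hst _ y h1 h2 h3 h4

theorem card_le_of_forall_exists_colour {c : Sym2 V → ℕ}
    (hc : ProperColoring (⊤ : SimpleGraph V) c) {X : Finset V} {y : V} (hy : y ∉ X)
    {E : Finset (Sym2 V)} (h : ∀ x ∈ X, ∃ e ∈ E, c e = c s(x, y)) : X.card ≤ E.card := by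
  have hinj : Set.InjOn (fun x => c s(y, x)) X := by
    intro x hx x' hx' heq
    by_contra hne
    exact hc (by rintro rfl; exact hy hx) (by rintro rfl; exact hy hx') hne heq
  rw [← card_image_of_injOn hinj]
  refine (card_le_card (t := E.image c) fun γ hγ => ?_).trans card_image_le
  obtain ⟨x, hx, rfl⟩ := mem_image.1 hγ
  obtain ⟨e, he, hce⟩ := h x hx
  exact mem_image.2 ⟨e, he, by rw [hce, Sym2.eq_swap]⟩

theorem deg_eq_card (F : SimpleGraph V) (v : V) :
    deg F v = (univ.filter fun w => F.Adj v w).card := by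
  rw [deg, Set.ncard_eq_toFinset_card']
  congr 1
  ext w
  simp

/-- The component of the root of a stuck partial tree contains at least half of the vertices,
up to a small error. -/
theorem IsStuck.card_compl_component_le {c : Sym2 V → ℕ}
    (hc : ProperColoring (⊤ : SimpleGraph V) c) {H S F : SimpleGraph V} {σ D h : ℕ} {r x : V}
    (hst : IsStuck c H S σ D r F) (hF : PartialTree c H S σ D r F) (hS : ∀ v, deg S v + 1 ≤ D)
    (hH : ∀ v, deg H v ≤ h) (hx : F.Reachable r x) (hdx : deg F x + 1 ≤ D) :
    (component F r)ᶜ.card ≤ h + size F := by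
  have hsub : (component F r)ᶜ ⊆ (univ.filter fun w => H.Adj x w) ∪
      ((component F r)ᶜ.filter fun w => ¬H.Adj x w) := by
    intro w hw
    by_cases hxw : H.Adj x w <;> simp [hxw]
    simpa using hw
  refine (card_le_card hsub).trans ((card_union_le _ _).trans (Nat.add_le_add ?_ ?_))
  · rw [← deg_eq_card]
    exact hH x
  · rw [size_eq_card]
    refine card_le_of_forall_exists_colour hc (y := x) ?_ fun y hy => ?_
    · simp [mem_component, hx]
    · simp only [mem_filter, mem_compl, mem_component] at hy
      obtain ⟨e, he, hce⟩ := hst.exists_colour hF hS hx hy.1 hy.2 hdx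
      exact ⟨e, he, by rw [hce, Sym2.eq_swap]⟩

/-- In a stuck partial tree, every pair of an unused colour is of one of a few special types. -/
theorem IsStuck.exists_exceptional {c : Sym2 V → ℕ}
    (hc : ProperColoring (⊤ : SimpleGraph V) c) {H S F : SimpleGraph V} {σ D h : ℕ} {r y : V}
    (hst : IsStuck c H S σ D r F) (hF : PartialTree c H S σ D r F) (hS : ∀ v, deg S v + 1 ≤ D)
    (hH : ∀ v, deg H v ≤ h) (hσ : size S = σ) (hy : ¬F.Reachable r y) :
    ∃ N : Finset V, N.card ≤ 2 * (2 * σ + (fullVertices F D).card + h) ∧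
      ∀ a b, a ≠ b → (∀ e ∈ F.edgeFinset, c e ≠ c s(a, b)) →
        H.Adj a b ∨ a ∈ fullVertices F D ∨ b ∈ fullVertices F D ∨
          (a ∉ component F r ∧ b ∉ component F r) ∨ (a ∈ N ∧ b ∈ N) := by
  set A := component F r with hA
  set X := A.filter fun x => ¬H.Adj x y ∧ x ∉ fullVertices F D with hX
  have hAX : A.card ≤ X.card + (fullVertices F D).card + h := by
    have hsub : A ⊆ (X ∪ fullVertices F D) ∪ univ.filter fun w => H.Adj y w := by
      intro w hw
      by_cases h1 : H.Adj y w
      · simp [h1]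
      · by_cases h2 : w ∈ fullVertices F D
        · simp [h2]
        · have : ¬H.Adj w y := fun h => h1 h.symm
          simp [hX, hw, h2, this]
    refine (card_le_card hsub).trans ((card_union_le _ _).trans (Nat.add_le_add
      (card_union_le _ _) ?_))
    rw [← deg_eq_card]
    exact hH y
  set P := F.edgeFinset.filter fun e => ∃ x ∈ X, c e = c s(x, y) with hP
  have hXP : X.card ≤ P.card := by
    refine card_le_of_forall_exists_colour hc (y := y) ?_ fun x hx => ?_
    · simp [hX, hA, mem_component, hy]
    · have hx' := hx
      simp only [hX, hA, mem_filter, mem_component, mem_fullVertices, not_le] at hx'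
      obtain ⟨e, he, hce⟩ := hst.exists_colour hF hS hx'.1 hy hx'.2.1 (by omega)
      exact ⟨e, mem_filter.2 ⟨he, x, hx, hce⟩, hce⟩
  set B := S.edgeFinset ∪ (F.edgeFinset \ P) with hB
  have hBcard : B.card + X.card ≤ σ + size F := by
    have h1 : B.card ≤ S.edgeFinset.card + (F.edgeFinset \ P).card := card_union_le _ _
    have hPF : P ⊆ F.edgeFinset := filter_subset _ _
    have h2 := card_sdiff_add_card_eq_card hPF
    rw [← size_eq_card] at h1 h2
    omega
  refine ⟨univ.filter fun v : V => ∃ e ∈ B, v ∈ e, (card_covered_le B).trans ?_, ?_⟩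
  · have : size F + 1 ≤ A.card + σ := hF.size_le
    omega
  have key : ∀ a b, a ≠ b → (∀ e ∈ F.edgeFinset, c e ≠ c s(a, b)) → ¬H.Adj a b →
      a ∉ fullVertices F D → b ∉ fullVertices F D → F.Reachable r a → F.Reachable r b →
      ∃ e ∈ B, a ∈ e := by
    intro a b hab hcab hHab ha hb hra hrb
    simp only [mem_fullVertices, not_le] at ha hb
    obtain ⟨a', hadj, hsep⟩ := exists_adj_separating hF.acyclic hab (hra.symm.trans hrb)
    by_contra! hno
    have haB : s(a, a') ∉ B := fun hm => hno _ hm (Sym2.mem_mk_left a a')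
    simp only [hB, mem_union, mem_sdiff, not_or, not_and, not_not, mem_edgeFinset,
      mem_edgeSet] at haB
    obtain ⟨x, hx, hcx⟩ := (mem_filter.1 (haB.2 hadj)).2
    simp only [hX, hA, mem_filter, mem_component, mem_fullVertices, not_le] at hx
    obtain ⟨F', h1, h2, h3, h4⟩ := hF.exchange_extend hra hrb hHab (by omega) (by omega)
      (fun e he => hcab e (by simpa using he)) hadj haB.1 hsep hx.1 hy hx.2.1 (by omega) (hS y) hcx
    exact hst F' y h1 h2 h3 h4
  intro a b hab hcab
  by_contra! hcon
  obtain ⟨hHab, ha, hb, hout, hN⟩ := hcon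
  by_cases hra : F.Reachable r a <;> by_cases hrb : F.Reachable r b
  · have h1 := key a b hab hcab hHab ha hb hra hrb
    have h2 := key b a hab.symm (by rwa [Sym2.eq_swap]) (fun h => hHab h.symm) hb ha hrb hra
    exact hN (by simpa using h1) (by simpa using h2)
  · obtain ⟨e, he, hce⟩ := hst.exists_colour hF hS hra hrb hHab
      (by rw [mem_fullVertices] at ha; omega)
    exact hcab e he hce
  · obtain ⟨e, he, hce⟩ := hst.exists_colour hF hS hrb hra (fun h => hHab h.symm)
      (by rw [mem_fullVertices] at hb; omega)
    exact hcab e he (by rw [hce, Sym2.eq_swap])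
  · exact hrb (mem_component.1 (hout fun h => hra (mem_component.1 h)))

/-- A rainbow forest with `σ` edges and bounded degrees using only colours of few edges. -/
structure IsSeed (c : Sym2 V → ℕ) (S : SimpleGraph V) (σ : ℕ) : Prop where
  acyclic : S.IsAcyclic
  rainbow : IsRainbow c S.edgeSet
  small : ∀ e ∈ S.edgeSet, 5 * (colourPairs c (c e)).card ≤ Fintype.card V
  size_eq : size S = σ
  deg_le : ∀ v, deg S v ≤ 10

/-- The colours appearing on many edges. -/
noncomputable def largeColours (c : Sym2 V → ℕ) : Finset ℕ :=
  (univ.image fun p : V × V => c s(p.1, p.2)).filter fun γ =>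
    Fintype.card V < 5 * (colourPairs c γ).card

theorem mem_largeColours {c : Sym2 V → ℕ} {γ : ℕ} :
    γ ∈ largeColours c ↔ Fintype.card V < 5 * (colourPairs c γ).card := by
  refine ⟨fun h => (mem_filter.1 h).2, fun h => mem_filter.2 ⟨?_, h⟩⟩
  obtain ⟨p, hp⟩ : (colourPairs c γ).Nonempty := by
    rw [← card_pos]
    omega
  exact mem_image.2 ⟨p, mem_univ _, (mem_colourPairs.1 hp).2⟩

/-- The ordered pairs of distinct vertices whose colour is not used by `F`. -/
noncomputable def unusedPairs (c : Sym2 V → ℕ) (F : SimpleGraph V) : Finset (V × V) :=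
  univ.filter fun p => p.1 ≠ p.2 ∧ ∀ e ∈ F.edgeFinset, c e ≠ c s(p.1, p.2)

theorem sum_card_colourPairs_le {c : Sym2 V → ℕ} (hc : ProperColoring (⊤ : SimpleGraph V) c)
    {S F : SimpleGraph V} {σ : ℕ} (hS : IsSeed c S σ) (hSF : S ≤ F) :
    5 * ∑ e ∈ F.edgeFinset, (colourPairs c (c e)).card + 4 * (σ * Fintype.card V) ≤
      5 * (size F * Fintype.card V) := by
  have hsub : S.edgeFinset ⊆ F.edgeFinset := edgeFinset_mono hSF
  have h1 : ∑ e ∈ F.edgeFinset \ S.edgeFinset, (colourPairs c (c e)).card ≤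
      (F.edgeFinset \ S.edgeFinset).card * Fintype.card V :=
    sum_le_card_nsmul _ _ _ fun e _ => card_colourPairs_le hc _
  have h2 : ∑ e ∈ S.edgeFinset, 5 * (colourPairs c (c e)).card ≤
      S.edgeFinset.card * Fintype.card V :=
    sum_le_card_nsmul _ _ _ fun e he => hS.small e (mem_edgeFinset.1 he)
  have h3 := card_sdiff_add_card_eq_card hsub
  rw [← sum_sdiff hsub]
  rw [← mul_sum] at h2
  rw [← size_eq_card S, hS.size_eq] at h2 h3
  rw [size_eq_card F, ← h3]
  linarith

theorem le_card_unusedPairs (c : Sym2 V → ℕ) (F : SimpleGraph V) :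
    Fintype.card V * Fintype.card V ≤ (unusedPairs c F).card + Fintype.card V +
      ∑ e ∈ F.edgeFinset, (colourPairs c (c e)).card := by
  have hsub : (univ : Finset (V × V)) ⊆ (unusedPairs c F ∪ univ.image fun v => (v, v)) ∪
      F.edgeFinset.biUnion fun e => colourPairs c (c e) := by
    rintro ⟨a, b⟩ -
    by_cases hab : a = b
    · simp [hab]
    by_cases hcab : ∀ e ∈ F.edgeFinset, c e ≠ c s(a, b)
    · refine mem_union_left _ (mem_union_left _ ?_)
      exact mem_filter.2 ⟨mem_univ _, hab, hcab⟩
    · push Not at hcab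
      obtain ⟨e, he, hce⟩ := hcab
      exact mem_union_right _ (mem_biUnion.2 ⟨e, he, mem_colourPairs.2 ⟨hab, hce.symm⟩⟩)
  have hcard := card_le_card hsub
  rw [card_univ, Fintype.card_prod] at hcard
  refine hcard.trans ((card_union_le _ _).trans (Nat.add_le_add ((card_union_le _ _).trans
    (Nat.add_le_add_left ?_ _)) card_biUnion_le))
  exact card_image_le.trans (by rw [card_univ])

theorem card_unusedPairs_le {c : Sym2 V → ℕ} {H F : SimpleGraph V} {f o N : Finset V} {h : ℕ}
    (hH : ∀ v, deg H v ≤ h)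
    (hex : ∀ a b, a ≠ b → (∀ e ∈ F.edgeFinset, c e ≠ c s(a, b)) →
      H.Adj a b ∨ a ∈ f ∨ b ∈ f ∨ (a ∈ o ∧ b ∈ o) ∨ (a ∈ N ∧ b ∈ N)) :
    (unusedPairs c F).card ≤ Fintype.card V * h + 2 * (f.card * Fintype.card V) +
      o.card * o.card + N.card * N.card := by
  have hsub : unusedPairs c F ⊆ ((((univ.filter fun p : V × V => H.Adj p.1 p.2) ∪ f ×ˢ univ) ∪
      univ ×ˢ f) ∪ o ×ˢ o) ∪ N ×ˢ N := by
    rintro ⟨a, b⟩ hab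
    obtain ⟨-, hab, hcab⟩ := mem_filter.1 hab
    have := hex a b hab hcab
    simp only [mem_union, mem_product, mem_filter, mem_univ, true_and, and_true]
    tauto
  have hHcard : (univ.filter fun p : V × V => H.Adj p.1 p.2).card ≤ Fintype.card V * h := by
    rw [card_adj_pairs, ← sum_deg, ← card_univ, ← smul_eq_mul]
    exact sum_le_card_nsmul _ _ _ fun v _ => hH v
  refine (card_le_card hsub).trans ((card_union_le _ _).trans (Nat.add_le_add
    ((card_union_le _ _).trans (Nat.add_le_add ((card_union_le _ _).trans ?_) ?_)) ?_))
  · have := (card_union_le (univ.filter fun p : V × V => H.Adj p.1 p.2) (f ×ˢ univ)).trans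
      (Nat.add_le_add_right hHcard _)
    rw [card_product, card_univ] at this
    rw [card_product, card_univ]
    linarith
  · rw [card_product]
  · rw [card_product]

/-- A colour class all of whose pairs lie in `H` or meet `X` is small. -/
theorem card_colourPairs_le_of_exceptional {c : Sym2 V → ℕ}
    (hc : ProperColoring (⊤ : SimpleGraph V) c) {H : SimpleGraph V} {X : Finset V} {h γ : ℕ}
    (hH : ((colourPairs c γ).filter fun p => H.Adj p.1 p.2).card ≤ h)
    (hex : ∀ p ∈ colourPairs c γ, H.Adj p.1 p.2 ∨ p.1 ∈ X ∨ p.2 ∈ X) :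
    (colourPairs c γ).card ≤ h + 2 * X.card := by
  have hsub : colourPairs c γ ⊆ (((colourPairs c γ).filter fun p => H.Adj p.1 p.2) ∪
      (colourPairs c γ).filter fun p => p.1 ∈ X) ∪ (colourPairs c γ).filter fun p => p.2 ∈ X := by
    intro p hp
    have := hex p hp
    simp only [mem_union, mem_filter]
    tauto
  have h1 := card_colourPairs_fst_le hc γ X
  have h2 := card_colourPairs_snd_le hc γ X
  refine (card_le_card hsub).trans ((card_union_le _ _).trans ((Nat.add_le_add
    ((card_union_le _ _).trans (Nat.add_le_add hH h1)) h2).trans ?_))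
  omega

theorem exists_unused_largeColour {c : Sym2 V → ℕ} {S F : SimpleGraph V} {σ : ℕ}
    (hS : IsSeed c S σ) (hSF : S ≤ F) (hlt : size F < (largeColours c).card + σ) :
    ∃ γ ∈ largeColours c, ∀ e ∈ F.edgeFinset, c e ≠ γ := by
  by_contra! hcon
  have hsub : S.edgeFinset ⊆ F.edgeFinset := edgeFinset_mono hSF
  have hle : (largeColours c).card ≤ (F.edgeFinset \ S.edgeFinset).card := by
    refine (card_le_card fun γ hγ => ?_).trans (card_image_le (f := c))
    obtain ⟨e, he, rfl⟩ := hcon γ hγ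
    refine mem_image_of_mem _ (mem_sdiff.2 ⟨he, fun heS => ?_⟩)
    have := hS.small e (mem_edgeFinset.1 heS)
    have := mem_largeColours.1 hγ
    omega
  have h3 := card_sdiff_add_card_eq_card hsub
  rw [← size_eq_card, ← size_eq_card, hS.size_eq] at h3
  omega

theorem counting_estimate {n o f h N σ m t u : ℕ} (hh : 100000 * h ≤ n)
    (hf : 100000 * f ≤ 2 * n) (hN : 100000 * N ≤ 406 * n)
    (hU : u ≤ n * h + 2 * (f * n) + o * o + N * N) (hU' : n * n ≤ u + n + t)
    (hsum : 5 * t + 4 * (σ * n) ≤ 5 * (m * n)) :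
    499900 * (n * n) + 400000 * (σ * n) ≤ 500000 * n + 500000 * (m * n) + 500000 * (o * o) := by
  have e1 : 100000 * (n * h) ≤ n * n := by
    calc _ = n * (100000 * h) := by ring
      _ ≤ _ := Nat.mul_le_mul_left _ hh
  have e2 : 100000 * (f * n) ≤ 2 * (n * n) := by
    calc _ = (100000 * f) * n := by ring
      _ ≤ (2 * n) * n := Nat.mul_le_mul_right _ hf
      _ = _ := by ring
  have e3 : 100000 * (N * N) ≤ 2 * (n * n) := by
    have e : 10000000000 * (N * N) ≤ 164836 * (n * n) := by
      calc _ = (100000 * N) * (100000 * N) := by ring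
        _ ≤ (406 * n) * (406 * n) := Nat.mul_le_mul hN hN
        _ = _ := by ring
    omega
  omega

theorem uncovered_le {n o σ h m : ℕ} (hh : 100000 * h ≤ n) (hσ : 1000 * σ ≤ n)
    (ho : o ≤ h + m) (hm : m + o + 1 ≤ n + σ)
    (hcount : 499900 * (n * n) + 400000 * (σ * n) ≤
      500000 * n + 500000 * (m * n) + 500000 * (o * o)) :
    500 * o ≤ n := by
  by_contra! hcon
  have e5 : 200000 * (o * o) ≤ 100101 * (o * n) := by
    have e4 : 200000 * o ≤ 100101 * n := by omega
    calc _ = o * (200000 * o) := by ring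
      _ ≤ o * (100101 * n) := Nat.mul_le_mul_left _ e4
      _ = _ := by ring
  have e7 : m * n + o * n + n ≤ n * n + σ * n := by
    calc _ = (m + o + 1) * n := by ring
      _ ≤ (n + σ) * n := Nat.mul_le_mul_right _ hm
      _ = _ := by ring
  have e8 : n * n ≤ 500 * (o * n) := by
    calc _ ≤ (500 * o) * n := Nat.mul_le_mul_right _ hcon.le
      _ = _ := by ring
  have e9 : 1000 * (σ * n) ≤ n * n := by
    calc _ = (1000 * σ) * n := by ring
      _ ≤ _ := Nat.mul_le_mul_right _ hσ
  have : 0 < n * n := by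
    rcases Nat.eq_zero_or_pos n with rfl | h0
    · omega
    · exact Nat.mul_pos h0 h0
  omega

theorem uncovered_slack_contradiction {n o σ m : ℕ} (hn : 1000000 ≤ n) (ho : 500 * o ≤ n)
    (hσ : n ≤ 1000 * σ + 999) (hm : m + 2 ≤ n)
    (hcount : 499900 * (n * n) + 400000 * (σ * n) ≤
      500000 * n + 500000 * (m * n) + 500000 * (o * o)) : False := by
  have e4 : 250000 * (o * o) ≤ n * n := by
    calc _ = (500 * o) * (500 * o) := by ring
      _ ≤ _ := Nat.mul_le_mul ho ho
  have e5 : m * n + 2 * n ≤ n * n := by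
    calc _ = (m + 2) * n := by ring
      _ ≤ _ := Nat.mul_le_mul_right _ hm
  have e6 : n * n ≤ 1000 * (σ * n) + 999 * n := by
    calc _ ≤ (1000 * σ + 999) * n := Nat.mul_le_mul_right _ hσ
      _ = _ := by ring
  have e7 : 1000000 * n ≤ n * n := Nat.mul_le_mul_right _ hn
  omega

/-- A partial tree that does not yet span can be enlarged. -/
theorem PartialTree.not_isStuck {c : Sym2 V → ℕ} (hc : ProperColoring (⊤ : SimpleGraph V) c)
    {H S F : SimpleGraph V} {σ h : ℕ} {r x y : V} (hn : 1000000 ≤ Fintype.card V)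
    (hS : IsSeed c S σ) (hh : 100000 * h ≤ Fintype.card V) (hσ : 1000 * σ ≤ Fintype.card V)
    (hlarge : Fintype.card V ≤ 1000 * σ + 999 ∨
      Fintype.card V ≤ (largeColours c).card + σ + 1)
    (hH : ∀ v, deg H v ≤ h)
    (hHc : ∀ γ, ((colourPairs c γ).filter fun p => H.Adj p.1 p.2).card ≤ h)
    (hF : PartialTree c H S σ 100001 r F) (hx : F.Reachable r x) (hdx : deg F x ≤ 11)
    (hy : ¬F.Reachable r y) : ¬IsStuck c H S σ 100001 r F := by
  intro hst
  have hSD : ∀ v, deg S v + 1 ≤ 100001 := fun v => by have := hS.deg_le v; omega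
  obtain ⟨N, hNcard, hex⟩ := hst.exists_exceptional hc hF hSD hH hS.size_eq hy
  have hhalf := hst.card_compl_component_le hc hF hSD hH hx (by omega)
  have hcompl := card_compl_add_card (component F r)
  have hsize := hF.size_le
  have hsize2 : size F + 2 ≤ Fintype.card V := size_add_two_le F hF.acyclic hy
  have hfull : (fullVertices F 100001).card * 100000 ≤ 2 * size F := by
    refine le_trans (le_of_eq ?_) (card_high_degree_mul_le F 100000)
    congr 2
    ext v
    simp [fullVertices]
  have hU := card_unusedPairs_le (f := fullVertices F 100001) (o := (component F r)ᶜ) hH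
    (fun a b hab h => by simpa only [mem_compl] using hex a b hab h)
  have hU' := le_card_unusedPairs c F
  have hsum := sum_card_colourPairs_le hc hS hF.le
  set n := Fintype.card V with hn'
  set o := (component F r)ᶜ.card with ho
  set f := (fullVertices F 100001).card with hf
  set u := (unusedPairs c F).card
  set t := ∑ e ∈ F.edgeFinset, (colourPairs c (c e)).card
  set m := size F
  have hN' : 100000 * N.card ≤ 406 * n := by omega
  have hcount := counting_estimate hh (by omega) hN' hU hU' hsum
  have hosmall : 500 * o ≤ n := uncovered_le hh hσ hhalf (by omega) hcount
  rcases hlarge with hslack | hexact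
  · exact uncovered_slack_contradiction hn hosmall hslack hsize2 hcount
  · obtain ⟨γ, hγ, hγF⟩ := exists_unused_largeColour hS hF.le (by omega)
    rw [mem_largeColours] at hγ
    have hle := card_colourPairs_le_of_exceptional hc
      (X := (fullVertices F 100001 ∪ (component F r)ᶜ) ∪ N) (hHc γ) (by
        rintro ⟨a, b⟩ hp
        rw [mem_colourPairs] at hp
        have := hex a b hp.1 (by rw [hp.2]; exact hγF)
        simp only [mem_union, mem_compl]
        tauto)
    have h1 := card_union_le (fullVertices F 100001 ∪ (component F r)ᶜ) N
    have h2 := card_union_le (fullVertices F 100001) (component F r)ᶜ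
    omega

/-- A seed can be completed to a rainbow spanning tree avoiding a sparse graph. -/
theorem IsSeed.exists_isTree {c : Sym2 V → ℕ} (hc : ProperColoring (⊤ : SimpleGraph V) c)
    {H S : SimpleGraph V} {σ h : ℕ} (hn : 1000000 ≤ Fintype.card V)
    (hS : IsSeed c S σ) (hh : 100000 * h ≤ Fintype.card V) (hσ : 1000 * σ ≤ Fintype.card V)
    (hlarge : Fintype.card V ≤ 1000 * σ + 999 ∨
      Fintype.card V ≤ (largeColours c).card + σ + 1)
    (hH : ∀ v, deg H v ≤ h)
    (hHc : ∀ γ, ((colourPairs c γ).filter fun p => H.Adj p.1 p.2).card ≤ h)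
    (hSH : Disjoint S H) :
    ∃ T : SimpleGraph V, T.IsTree ∧ IsRainbow c T.edgeSet ∧ Disjoint T H ∧
      ∀ v, deg T v ≤ 100001 := by
  have hne : Nonempty V := Fintype.card_pos_iff.1 (by omega)
  obtain ⟨r⟩ := hne
  have hgrow : ∀ d (F : SimpleGraph V), PartialTree c H S σ 100001 r F →
      (∃ x, F.Reachable r x ∧ deg F x ≤ 11) → Fintype.card V ≤ size F + 1 + d →
      ∃ T : SimpleGraph V, PartialTree c H S σ 100001 r T ∧ ∀ y, T.Reachable r y := by
    intro d
    induction d with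
    | zero =>
      intro F hF _ hd
      refine ⟨F, hF, fun y => ?_⟩
      by_contra hy
      have := size_add_two_le F hF.acyclic hy
      omega
    | succ d ih =>
      rintro F hF ⟨x, hx, hdx⟩ hd
      by_cases hall : ∀ y, F.Reachable r y
      · exact ⟨F, hF, hall⟩
      push Not at hall
      obtain ⟨y, hy⟩ := hall
      have := hF.not_isStuck hc hn hS hh hσ hlarge hH hHc hx hdx hy
      simp only [IsStuck, not_forall, not_not] at this
      obtain ⟨F', z, hF', hz, hdz, hs⟩ := this
      have := hS.deg_le z
      exact ih F' hF' ⟨z, hz, by omega⟩ (by omega)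
  have hSH' : ∀ u v, S.Adj u v → ¬H.Adj u v := fun u v hu hv =>
    (disjoint_iff_inf_le.1 hSH : S ⊓ H ≤ ⊥) ⟨hu, hv⟩
  obtain ⟨T, hT, hTall⟩ := hgrow (Fintype.card V) S
    ⟨le_rfl, hS.acyclic, hS.rainbow, hSH', fun v => (hS.deg_le v).trans (by norm_num),
      fun u v h1 h2 => absurd h1 h2, by
        rw [hS.size_eq, add_comm]
        exact Nat.add_le_add_right (card_pos.2 ⟨r, mem_component.2 .rfl⟩) σ⟩
    ⟨r, .rfl, (hS.deg_le r).trans (by norm_num)⟩ (by omega)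
  refine ⟨T, ⟨?_, hT.acyclic⟩, hT.rainbow, ?_, hT.deg_le⟩
  · have : Nonempty V := ⟨r⟩
    exact Connected.mk fun a b => (hTall a).symm.trans (hTall b)
  · refine disjoint_iff_inf_le.2 fun a b hab => ?_
    exact absurd hab.2 (hT.avoids a b hab.1)

theorem le_card_smallPairs {c : Sym2 V → ℕ} (hc : ProperColoring (⊤ : SimpleGraph V) c) :
    Fintype.card V * Fintype.card V ≤
      (univ.filter fun p : V × V => p.1 ≠ p.2 ∧ c s(p.1, p.2) ∉ largeColours c).card +
        Fintype.card V + (largeColours c).card * Fintype.card V := by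
  have hsub : (univ : Finset (V × V)) ⊆
      ((univ.filter fun p : V × V => p.1 ≠ p.2 ∧ c s(p.1, p.2) ∉ largeColours c) ∪
        univ.image fun v => (v, v)) ∪ (largeColours c).biUnion fun γ => colourPairs c γ := by
    rintro ⟨a, b⟩ -
    by_cases hab : a = b
    · simp [hab]
    by_cases hcab : c s(a, b) ∈ largeColours c
    · exact mem_union_right _ (mem_biUnion.2 ⟨_, hcab, mem_colourPairs.2 ⟨hab, rfl⟩⟩)
    · exact mem_union_left _ (mem_union_left _ (mem_filter.2 ⟨mem_univ _, hab, hcab⟩))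
  have hcard := card_le_card hsub
  rw [card_univ, Fintype.card_prod] at hcard
  refine hcard.trans ((card_union_le _ _).trans (Nat.add_le_add ((card_union_le _ _).trans
    (Nat.add_le_add_left ?_ _)) (card_biUnion_le_card_mul _ _ _ fun γ _ =>
      card_colourPairs_le hc γ)))
  exact card_image_le.trans (by rw [card_univ])

/-- Adding a suitable edge of a colour of few edges to a seed. -/
theorem IsSeed.sup_edge {c : Sym2 V → ℕ} {S : SimpleGraph V} {j : ℕ} {a b : V}
    (hS : IsSeed c S j) (hab : a ≠ b) (hcab : c s(a, b) ∉ largeColours c)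
    (hc : ∀ e ∈ S.edgeFinset, c e ≠ c s(a, b)) (ha : deg S a < 10)
    (hb : ∀ w, ¬S.Adj b w) : IsSeed c (S ⊔ edge a b) (j + 1) := by
  have hnr : ¬S.Reachable a b := by
    intro hr
    obtain ⟨p⟩ := hr.symm
    cases p with
    | nil => exact hab rfl
    | cons h _ => exact hb _ h
  have hb0 : deg S b = 0 := by
    rw [deg_eq_card, card_eq_zero, filter_eq_empty_iff]
    exact fun w _ => hb w
  refine ⟨hS.acyclic.sup_edge_of_not_reachable hnr,
    isRainbow_sup_edge hS.rainbow fun e he => hc e (by simpa using he), ?_, ?_, ?_⟩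
  · intro e he
    rw [edgeSet_sup_edge S hab] at he
    rcases he with rfl | he
    · rwa [mem_largeColours, not_lt] at hcab
    · exact hS.small e he
  · rw [size_sup_edge S hab fun h => hnr h.reachable, hS.size_eq]
  · intro v
    by_cases hva : v = a
    · subst hva
      exact (deg_sup_edge_le S v b v).trans ha
    by_cases hvb : v = b
    · subst hvb
      exact (deg_sup_edge_le S a v v).trans (by omega)
    · rw [deg_sup_edge_of_ne S hva hvb]
      exact hS.deg_le v

theorem seed_counting_contradiction {n ℓ j σ H f N t u : ℕ} (hj : j < σ) (hσ : 1000 * σ ≤ n)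
    (hlarge : ℓ + σ + 1 ≤ n) (hH : 20 * H ≤ σ * n) (hf : f * 10 ≤ 2 * j) (hN : N ≤ 2 * j)
    (hsum : 5 * t + 4 * (j * n) ≤ 5 * (j * n)) (hu : u ≤ 2 * H + t + f * n + n * f + N * N)
    (hsmall : n * n ≤ u + n + ℓ * n) : False := by
  have e1 : ℓ * n + σ * n + n ≤ n * n := by
    calc _ = (ℓ + σ + 1) * n := by ring
      _ ≤ _ := Nat.mul_le_mul_right _ hlarge
  have e2 : 5 * (f * n) ≤ j * n := by
    calc _ = (5 * f) * n := by ring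
      _ ≤ _ := Nat.mul_le_mul_right _ (by omega)
  have e3 : 500 * (N * N) ≤ 2 * (j * n) := by
    calc _ = N * (500 * N) := by ring
      _ ≤ (2 * j) * n := Nat.mul_le_mul hN (by omega)
      _ = _ := by ring
  have e4 : j * n + n ≤ σ * n := by
    calc _ = (j + 1) * n := by ring
      _ ≤ _ := Nat.mul_le_mul_right _ hj
  rw [mul_comm n f] at hu
  omega

theorem IsSeed.exists_succ {c : Sym2 V → ℕ} (hc : ProperColoring (⊤ : SimpleGraph V) c)
    {H S : SimpleGraph V} {j σ : ℕ} (hS : IsSeed c S j) (hj : j < σ)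
    (hσ : 1000 * σ ≤ Fintype.card V) (hlarge : (largeColours c).card + σ + 1 ≤ Fintype.card V)
    (hH : 20 * size H ≤ σ * Fintype.card V) (hSH : Disjoint S H) :
    ∃ S' : SimpleGraph V, IsSeed c S' (j + 1) ∧ Disjoint S' H := by
  by_contra! hcon
  set f := univ.filter fun v => 10 ≤ deg S v with hf
  set N := univ.filter fun v : V => ∃ e ∈ S.edgeFinset, v ∈ e with hN
  have key : ∀ a b, a ≠ b → c s(a, b) ∉ largeColours c →
      (∀ e ∈ S.edgeFinset, c e ≠ c s(a, b)) → ¬H.Adj a b → a ∉ f → b ∈ N := by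
    intro a b hab hcab hcS hHab ha
    by_contra hb
    have hb' : ∀ w, ¬S.Adj b w := fun w hw => hb (by
      simp only [hN, mem_filter, mem_univ, true_and]
      exact ⟨s(b, w), by simpa using hw, Sym2.mem_mk_left b w⟩)
    refine hcon _ (hS.sup_edge hab hcab hcS (by simpa [hf] using ha) hb') ?_
    refine disjoint_sup_left.2 ⟨hSH, SimpleGraph.disjoint_left.2 fun x y hxy => ?_⟩
    rw [edge_adj] at hxy
    rcases hxy with ⟨⟨rfl, rfl⟩ | ⟨rfl, rfl⟩, -⟩
    · exact hHab
    · exact fun h => hHab h.symm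
  have hsub : (univ.filter fun p : V × V => p.1 ≠ p.2 ∧ c s(p.1, p.2) ∉ largeColours c) ⊆
      ((((univ.filter fun p : V × V => H.Adj p.1 p.2) ∪
        S.edgeFinset.biUnion fun e => colourPairs c (c e)) ∪ f ×ˢ univ) ∪ univ ×ˢ f) ∪ N ×ˢ N := by
    rintro ⟨a, b⟩ hp
    obtain ⟨-, hab, hcab⟩ := mem_filter.1 hp
    by_cases hcS : ∀ e ∈ S.edgeFinset, c e ≠ c s(a, b)
    · have h1 := key a b hab hcab hcS
      have h2 := key b a hab.symm (by rwa [Sym2.eq_swap]) (by rwa [Sym2.eq_swap])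
      rw [H.adj_comm] at h2
      simp only [mem_union, mem_product, mem_filter, mem_univ, true_and, and_true]
      tauto
    · push Not at hcS
      obtain ⟨e, he, hce⟩ := hcS
      have : (a, b) ∈ S.edgeFinset.biUnion fun e => colourPairs c (c e) :=
        mem_biUnion.2 ⟨e, he, mem_colourPairs.2 ⟨hab, hce.symm⟩⟩
      exact mem_union_left _ (mem_union_left _ (mem_union_left _ (mem_union_right _ this)))
  have hcard := (card_le_card hsub).trans ((card_union_le _ _).trans (Nat.add_le_add
    ((card_union_le _ _).trans (Nat.add_le_add ((card_union_le _ _).trans (Nat.add_le_add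
      ((card_union_le _ _).trans (Nat.add_le_add_left card_biUnion_le _)) le_rfl)) le_rfl)) le_rfl))
  rw [card_adj_pairs, card_product, card_product, card_product, card_univ] at hcard
  have hsum := sum_card_colourPairs_le hc hS le_rfl
  have hfcard := card_high_degree_mul_le S 10
  have hNcard : N.card ≤ 2 * S.edgeFinset.card := card_covered_le _
  have hsmall := le_card_smallPairs hc
  rw [← size_eq_card, hS.size_eq] at hNcard
  rw [hS.size_eq] at hsum hfcard
  exact seed_counting_contradiction hj hσ hlarge hH hfcard hNcard hsum hcard hsmall

theorem IsSeed.bot (c : Sym2 V → ℕ) : IsSeed c (⊥ : SimpleGraph V) 0 := by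
  refine ⟨isAcyclic_bot, by simp [IsRainbow], by simp, by simp [size], fun v => ?_⟩
  simp [deg, neighborSet]

theorem exists_isSeed {c : Sym2 V → ℕ} (hc : ProperColoring (⊤ : SimpleGraph V) c)
    {H : SimpleGraph V} {σ : ℕ} (hσ : 1000 * σ ≤ Fintype.card V)
    (hlarge : σ ≤ Fintype.card V - 1 - (largeColours c).card)
    (hH : 20 * size H ≤ σ * Fintype.card V) :
    ∃ S : SimpleGraph V, IsSeed c S σ ∧ Disjoint S H := by
  have hgrow : ∀ j ≤ σ, ∃ S : SimpleGraph V, IsSeed c S j ∧ Disjoint S H := by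
    intro j
    induction j with
    | zero => exact fun _ => ⟨⊥, IsSeed.bot c, disjoint_bot_left⟩
    | succ j ih =>
      intro hj
      obtain ⟨S, hS, hSH⟩ := ih (by omega)
      exact hS.exists_succ hc hj hσ (by omega) hH hSH
  exact hgrow σ le_rfl

theorem size_finsetSup_le {ι : Type*} (s : Finset ι) (G : ι → SimpleGraph V) :
    size (s.sup G) ≤ ∑ i ∈ s, size (G i) := by
  induction s using Finset.induction_on with
  | empty => simp [size]
  | insert a s ha ih =>
    rw [sup_insert, sum_insert ha]
    refine le_trans ?_ (Nat.add_le_add_left ih _)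
    rw [size, edgeSet_sup]
    exact Set.ncard_union_le _ _

theorem adj_finsetSup {ι : Type*} (s : Finset ι) (G : ι → SimpleGraph V) {u v : V} :
    (s.sup G).Adj u v ↔ ∃ i ∈ s, (G i).Adj u v := by
  induction s using Finset.induction_on with
  | empty => simp
  | insert a s ha ih => simp [sup_insert, ih]

theorem deg_finsetSup_le {ι : Type*} (s : Finset ι) (G : ι → SimpleGraph V) (v : V) :
    deg (s.sup G) v ≤ ∑ i ∈ s, deg (G i) v := by
  simp only [deg_eq_card]
  refine (card_le_card fun w hw => ?_).trans card_biUnion_le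
  simpa [adj_finsetSup] using hw

theorem card_colourPairs_rainbow_le {c : Sym2 V → ℕ} {R : SimpleGraph V}
    (hR : IsRainbow c R.edgeSet) (γ : ℕ) :
    ((colourPairs c γ).filter fun p => R.Adj p.1 p.2).card ≤ 2 := by
  rcases ((colourPairs c γ).filter fun p => R.Adj p.1 p.2).eq_empty_or_nonempty with h | ⟨p, hp⟩
  · rw [h]
    simp
  · refine (card_le_card (t := {p, p.swap}) fun q hq => ?_).trans card_le_two
    rw [mem_filter, mem_colourPairs] at hp hq
    have h : s(p.1, p.2) = s(q.1, q.2) :=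
      hR (by simpa using hp.2) (by simpa using hq.2) (hp.1.2.trans hq.1.2.symm)
    rw [Sym2.eq_iff] at h
    simp only [mem_insert, mem_singleton, Prod.ext_iff, Prod.fst_swap, Prod.snd_swap]
    rcases h with ⟨h1, h2⟩ | ⟨h1, h2⟩
    · exact Or.inl ⟨h1.symm, h2.symm⟩
    · exact Or.inr ⟨h2.symm, h1.symm⟩

theorem card_colourPairs_finsetSup_le {ι : Type*} {c : Sym2 V → ℕ} (s : Finset ι)
    (G : ι → SimpleGraph V) (hG : ∀ i ∈ s, IsRainbow c (G i).edgeSet) (γ : ℕ) :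
    ((colourPairs c γ).filter fun p => (s.sup G).Adj p.1 p.2).card ≤ s.card * 2 := by
  refine (card_le_card fun p hp => ?_).trans (card_biUnion_le_card_mul s
    (fun i => (colourPairs c γ).filter fun p => (G i).Adj p.1 p.2) 2 fun i hi =>
      card_colourPairs_rainbow_le (hG i hi) γ)
  rw [mem_filter, adj_finsetSup] at hp
  obtain ⟨hp, i, hi, hadj⟩ := hp
  exact mem_biUnion.2 ⟨i, hi, mem_filter.2 ⟨hp, hadj⟩⟩

theorem exists_disjoint_isSeed {c : Sym2 V → ℕ} (hc : ProperColoring (⊤ : SimpleGraph V) c)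
    {σ : ℕ} (hσ : 1000 * σ ≤ Fintype.card V)
    (hlarge : σ ≤ Fintype.card V - 1 - (largeColours c).card) (k : ℕ)
    (hk : 20 * k ≤ Fintype.card V) :
    ∃ G : ℕ → SimpleGraph V, (∀ i < k, IsSeed c (G i) σ) ∧
      ∀ i < k, ∀ j < k, i ≠ j → Disjoint (G i) (G j) := by
  induction k with
  | zero => exact ⟨fun _ => ⊥, by simp, by simp⟩
  | succ k ih =>
    obtain ⟨G, hG, hdisj⟩ := ih (by omega)
    have hsize : size ((range k).sup G) ≤ k * σ := by
      refine (size_finsetSup_le _ _).trans ?_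
      rw [sum_congr rfl fun i hi => (hG i (mem_range.1 hi)).size_eq]
      simp
    obtain ⟨S, hS, hSH⟩ := exists_isSeed hc (H := (range k).sup G) hσ hlarge (by
      calc _ ≤ 20 * (k * σ) := Nat.mul_le_mul_left _ hsize
        _ = σ * (20 * k) := by ring
        _ ≤ _ := Nat.mul_le_mul_left _ (by omega))
    rw [Finset.disjoint_sup_right] at hSH
    refine ⟨Function.update G k S, fun i hi => ?_, fun i hi j hj hij => ?_⟩
    · by_cases hik : i = k
      · subst hik
        simpa using hS
      · rw [Function.update_of_ne hik]
        exact hG i (by omega)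
    · by_cases hik : i = k <;> by_cases hjk : j = k
      · omega
      · subst hik
        rw [Function.update_self, Function.update_of_ne hjk]
        exact hSH (mem_range.2 (by omega))
      · subst hjk
        rw [Function.update_self, Function.update_of_ne hik]
        exact (hSH (mem_range.2 (by omega))).symm
      · rw [Function.update_of_ne hik, Function.update_of_ne hjk]
        exact hdisj i (by omega) j (by omega) hij

/-- A large properly coloured complete graph contains linearly many disjoint rainbow spanning
trees. -/
theorem exists_disjoint_isTree {c : Sym2 V → ℕ} (hc : ProperColoring (⊤ : SimpleGraph V) c)
    (hn : 1000000 ≤ Fintype.card V) (k : ℕ) (hk : 10000100000 * k ≤ Fintype.card V) :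
    ∃ G : ℕ → SimpleGraph V, (∀ i < k, (G i).IsTree ∧ IsRainbow c (G i).edgeSet) ∧
      ∀ i < k, ∀ j < k, i ≠ j → Disjoint (G i) (G j) := by
  obtain ⟨σ, hσ, hlarge, hlarge'⟩ : ∃ σ, 1000 * σ ≤ Fintype.card V ∧
      σ ≤ Fintype.card V - 1 - (largeColours c).card ∧
      (Fintype.card V ≤ 1000 * σ + 999 ∨ Fintype.card V ≤ (largeColours c).card + σ + 1) :=
    ⟨min (Fintype.card V / 1000) (Fintype.card V - 1 - (largeColours c).card),
      by omega, by omega, by omega⟩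
  have hreplace : ∀ m ≤ k, ∃ G : ℕ → SimpleGraph V,
      (∀ i < k, IsRainbow c (G i).edgeSet ∧ ∀ v, deg (G i) v ≤ 100001) ∧
      (∀ i < m, (G i).IsTree) ∧ (∀ i < k, m ≤ i → IsSeed c (G i) σ) ∧
      ∀ i < k, ∀ j < k, i ≠ j → Disjoint (G i) (G j) := by
    intro m
    induction m with
    | zero =>
      intro _
      obtain ⟨G, hG, hdisj⟩ := exists_disjoint_isSeed hc hσ hlarge k (by omega)
      exact ⟨G, fun i hi => ⟨(hG i hi).rainbow, fun v => ((hG i hi).deg_le v).trans (by norm_num)⟩,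
        by simp, fun i hi _ => hG i hi, hdisj⟩
    | succ m ih =>
      intro hm
      obtain ⟨G, hG, htree, hseed, hdisj⟩ := ih (by omega)
      set s := (range k).erase m with hs
      have hsk : s.card ≤ k := (card_le_card (erase_subset _ _)).trans (by simp)
      have hsG : ∀ i ∈ s, i < k ∧ i ≠ m := fun i hi => by
        rw [hs, mem_erase, mem_range] at hi
        exact ⟨hi.2, hi.1⟩
      obtain ⟨T, hT, hTr, hTH, hTd⟩ := (hseed m (by omega) le_rfl).exists_isTree hc
        (H := s.sup G) (h := k * 100001) hn (by omega) hσ hlarge'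
        (fun v => (deg_finsetSup_le s G v).trans ((sum_le_card_nsmul _ _ _ fun i hi =>
          (hG i (hsG i hi).1).2 v).trans (Nat.mul_le_mul_right _ hsk)))
        (fun γ => (card_colourPairs_finsetSup_le s G (fun i hi => (hG i (hsG i hi).1).1) γ).trans
          (Nat.mul_le_mul hsk (by norm_num)))
        (Finset.disjoint_sup_right.2 fun i hi =>
          hdisj m (by omega) i (hsG i hi).1 (hsG i hi).2.symm)
      rw [Finset.disjoint_sup_right] at hTH
      have hTG : ∀ i < k, i ≠ m → Disjoint T (G i) := fun i hi him =>
        hTH (by rw [hs, mem_erase, mem_range]; exact ⟨him, hi⟩)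
      refine ⟨Function.update G m T, fun i hi => ?_, fun i hi => ?_, fun i hi him => ?_,
        fun i hi j hj hij => ?_⟩
      · by_cases him : i = m
        · subst him
          rw [Function.update_self]
          exact ⟨hTr, hTd⟩
        · rw [Function.update_of_ne him]
          exact hG i hi
      · by_cases him : i = m
        · subst him
          rwa [Function.update_self]
        · rw [Function.update_of_ne him]
          exact htree i (by omega)
      · rw [Function.update_of_ne (by omega)]
        exact hseed i hi (by omega)
      · by_cases him : i = m <;> by_cases hjm : j = m
        · omega
        · subst him
          rw [Function.update_self, Function.update_of_ne hjm]
          exact hTG j hj hjm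
        · subst hjm
          rw [Function.update_self, Function.update_of_ne him]
          exact (hTG i hi him).symm
        · rw [Function.update_of_ne him, Function.update_of_ne hjm]
          exact hdisj i hi j hj hij
  obtain ⟨G, hG, htree, -, hdisj⟩ := hreplace k le_rfl
  exact ⟨G, fun i hi => ⟨htree i hi, (hG i hi).1⟩, hdisj⟩

theorem isRainbow_starGraph {c : Sym2 V → ℕ} (hc : ProperColoring (⊤ : SimpleGraph V) c) (r : V) :
    IsRainbow c (starGraph r).edgeSet := by
  have hstar : ∀ e ∈ (starGraph r).edgeSet, ∃ w, r ≠ w ∧ e = s(r, w) := by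
    intro e
    induction e using Sym2.ind with
    | _ a b =>
      intro h
      rw [mem_edgeSet, starGraph_adj] at h
      obtain ⟨hab, rfl | rfl⟩ := h
      · exact ⟨b, hab, rfl⟩
      · exact ⟨a, hab.symm, Sym2.eq_swap⟩
  intro e he e' he' heq
  obtain ⟨w, hw, rfl⟩ := hstar e he
  obtain ⟨w', hw', rfl⟩ := hstar e' he'
  by_contra hne
  exact hc hw hw' (fun h => hne (by rw [h])) heq

end RainbowTrees

theorem stmt0 {V : Type*} [Fintype V] [DecidableEq V] (c : Sym2 V → ℕ)
    (hproper : ProperColoring (⊤ : SimpleGraph V) c) :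
    ∃ (k : ℕ) (T : Fin k → SimpleGraph V),
      (Fintype.card V : ℝ) / 10 ^ 12 ≤ (k : ℝ) ∧
      (∀ i, (T i).IsTree ∧ IsRainbow c (T i).edgeSet) ∧
      (∀ i j, i ≠ j → Disjoint ((T i).edgeSet) ((T j).edgeSet)) := by
  rcases isEmpty_or_nonempty V with hV | ⟨⟨r⟩⟩
  · exact ⟨0, fun _ => ⊥, by simp, fun i => i.elim0, fun i => i.elim0⟩
  rcases Nat.lt_or_ge (Fintype.card V) 1000000000000 with hn | hn
  · refine ⟨1, fun _ => SimpleGraph.starGraph r, ?_, fun _ => ⟨SimpleGraph.isTree_starGraph _,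
      RainbowTrees.isRainbow_starGraph hproper r⟩, fun i j hij => absurd (Subsingleton.elim i j) hij⟩
    rw [div_le_iff₀ (by positivity)]
    norm_num
    exact hn.le
  · obtain ⟨G, hG, hdisj⟩ := RainbowTrees.exists_disjoint_isTree hproper (by omega)
      (Fintype.card V / 1000000000000 + 1) (by omega)
    refine ⟨_, fun i => G i, ?_, fun i => hG i i.2, fun i j hij =>
      SimpleGraph.disjoint_edgeSet.2 (hdisj i i.2 j j.2 (Fin.val_ne_of_ne hij))⟩
    have h : Fintype.card V ≤ (Fintype.card V / 1000000000000 + 1) * 1000000000000 := by omega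
    rw [div_le_iff₀ (by positivity)]
    norm_num
    exact_mod_cast h
end

section
/- Let 0 < β ≤ 1/2. Every (β, βn)-robustly-coloured properly edge-coloured complete graph K_n contains at least β²n/2500 pairwise edge-disjoint rainbow spanning trees. -/
open scoped Classical

theorem exists_rainbow_subset_rank {K E α γ : Type*} [Field K] [AddCommGroup E] [Module K E]
    [FiniteDimensional K E] (φ : α → E) (c : α → γ) (D : Finset γ) (d : ℕ) (S : Finset α)
    (hS : ∀ J ⊆ D, J.card ≤
      Module.finrank K (Submodule.span K (φ '' {x | x ∈ S ∧ c x ∈ J})) + d) :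
    ∃ B ⊆ S, Set.InjOn c (B : Set α) ∧
      D.card ≤ Module.finrank K (Submodule.span K (φ '' (B : Set α))) + d := by
  induction S using Finset.strongInduction with
  | H S ih =>
    by_cases hinj : Set.InjOn c (S : Set α)
    · refine ⟨S, subset_rfl, hinj, (hS D subset_rfl).trans ?_⟩
      gcongr
      exact Submodule.finrank_mono (Submodule.span_mono (Set.image_mono fun x hx => hx.1))
    · simp only [Set.InjOn, not_forall] at hinj
      obtain ⟨a, ha, b, hb, hab, hne⟩ := hinj
      simp only [Finset.mem_coe] at ha hb
      by_contra hcon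
      have key : ∀ x ∈ S, ∃ J ⊆ D, c x ∈ J ∧ Module.finrank K (Submodule.span K
          (φ '' {y | y ∈ S.erase x ∧ c y ∈ J})) + d < J.card := by
        intro x hx
        by_contra hno
        push Not at hno
        obtain ⟨B, hB, h⟩ := ih (S.erase x) (Finset.erase_ssubset hx) (by
          intro J hJ
          by_cases hxJ : c x ∈ J
          · exact hno J hJ hxJ
          · have hset : {y | y ∈ S.erase x ∧ c y ∈ J} = {y | y ∈ S ∧ c y ∈ J} := by
              ext y
              simp only [Finset.mem_erase, Set.mem_ofPred_eq, and_congr_left_iff]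
              rintro hy
              exact ⟨fun h => h.2, fun h => ⟨by rintro rfl; exact hxJ hy, h⟩⟩
            rw [hset]
            exact hS J hJ)
        exact hcon ⟨B, hB.trans (Finset.erase_subset _ _), h⟩
      obtain ⟨J₁, hJ₁, ha₁, h₁⟩ := key a ha
      obtain ⟨J₂, hJ₂, hb₂, h₂⟩ := key b hb
      have hu := hS (J₁ ∪ J₂) (Finset.union_subset hJ₁ hJ₂)
      have hi := hS ((J₁ ∩ J₂).erase (c a))
        ((Finset.erase_subset _ _).trans (Finset.inter_subset_left.trans hJ₁))
      have hmem : c a ∈ J₁ ∩ J₂ := Finset.mem_inter.2 ⟨ha₁, hab ▸ hb₂⟩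
      have hc := Finset.card_union_add_card_inter J₁ J₂
      have hce := Finset.card_erase_add_one hmem
      have hsub := Submodule.finrank_sup_add_finrank_inf_eq
        (Submodule.span K (φ '' {y | y ∈ S.erase a ∧ c y ∈ J₁}))
        (Submodule.span K (φ '' {y | y ∈ S.erase b ∧ c y ∈ J₂}))
      have e₁ : Module.finrank K (Submodule.span K (φ '' {x | x ∈ S ∧ c x ∈ J₁ ∪ J₂})) ≤
          Module.finrank K ↥(Submodule.span K (φ '' {y | y ∈ S.erase a ∧ c y ∈ J₁}) ⊔
            Submodule.span K (φ '' {y | y ∈ S.erase b ∧ c y ∈ J₂})) := by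
        rw [← Submodule.span_union, ← Set.image_union]
        refine Submodule.finrank_mono (Submodule.span_mono (Set.image_mono ?_))
        rintro x ⟨hx, hxJ⟩
        simp only [Finset.mem_erase, Set.mem_union, Set.mem_ofPred_eq]
        rw [Finset.mem_union] at hxJ
        by_cases hxa : x = a
        · subst hxa; exact Or.inr ⟨⟨hne, hx⟩, hab ▸ hb₂⟩
        · by_cases hxb : x = b
          · subst hxb; exact Or.inl ⟨⟨hxa, hx⟩, hab ▸ ha₁⟩
          · tauto
      have e₂ : Module.finrank K
          (Submodule.span K (φ '' {x | x ∈ S ∧ c x ∈ (J₁ ∩ J₂).erase (c a)})) ≤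
          Module.finrank K ↥(Submodule.span K (φ '' {y | y ∈ S.erase a ∧ c y ∈ J₁}) ⊓
            Submodule.span K (φ '' {y | y ∈ S.erase b ∧ c y ∈ J₂})) := by
        refine Submodule.finrank_mono (le_inf ?_ ?_) <;>
          refine Submodule.span_mono (Set.image_mono ?_) <;>
          · rintro x ⟨hx, hxJ⟩
            simp only [Finset.mem_erase, Finset.mem_inter] at hxJ
            simp only [Finset.mem_erase, Set.mem_ofPred_eq]
            refine ⟨⟨?_, hx⟩, by tauto⟩
            rintro rfl
            simp_all
      omega

/-- The vertex-edge incidence vector over `ZMod 2`. -/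
noncomputable def incVec (W : Type*) : Sym2 W → W → ZMod 2 :=
  Sym2.lift ⟨fun a b => Pi.single a 1 + Pi.single b 1, fun _ _ => add_comm _ _⟩

theorem incVec_mk {W : Type*} (a b : W) :
    incVec W s(a, b) = Pi.single a 1 + Pi.single b 1 := rfl

theorem add_self_eq_zero_of_zmod_two {W : Type*} (x : W → ZMod 2) : x + x = 0 :=
  funext fun _ => CharTwo.add_self_eq_zero _

theorem card_le_rank_add_card_component {W : Type*} [Fintype W] (F : SimpleGraph W) :
    Fintype.card W ≤
      Module.finrank (ZMod 2) (Submodule.span (ZMod 2) (incVec W '' F.edgeSet)) +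
        Fintype.card F.ConnectedComponent := by
  set P := Submodule.span (ZMod 2) (incVec W '' F.edgeSet) with hP
  set Q := Submodule.span (ZMod 2)
    (Set.range fun C : F.ConnectedComponent => (Pi.single C.out 1 : W → ZMod 2)) with hQ
  have hreach : ∀ u v, F.Reachable u v →
      (Pi.single u 1 + Pi.single v 1 : W → ZMod 2) ∈ P := by
    rintro u v ⟨p⟩
    induction p with
    | nil => rw [add_self_eq_zero_of_zmod_two]; exact zero_mem _
    | @cons u v w h p ih =>
      have h1 : (Pi.single u 1 + Pi.single v 1 : W → ZMod 2) ∈ P :=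
        Submodule.subset_span ⟨s(u, v), h, rfl⟩
      have h2 := add_mem h1 ih
      convert h2 using 1
      rw [add_assoc, ← add_assoc (Pi.single v 1), add_self_eq_zero_of_zmod_two, zero_add]
  have htop : P ⊔ Q = ⊤ := by
    rw [eq_top_iff, ← (Pi.basisFun (ZMod 2) W).span_eq, Submodule.span_le]
    rintro _ ⟨u, rfl⟩
    simp only [Pi.basisFun_apply, SetLike.mem_coe]
    have h1 := hreach u (F.connectedComponentMk u).out
      (SimpleGraph.ConnectedComponent.exact (Quot.out_eq _).symm)
    have h2 : (Pi.single (F.connectedComponentMk u).out 1 : W → ZMod 2) ∈ Q :=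
      Submodule.subset_span ⟨_, rfl⟩
    have h3 := add_mem (Submodule.mem_sup_left (T := Q) h1) (Submodule.mem_sup_right (S := P) h2)
    rwa [add_assoc, add_self_eq_zero_of_zmod_two, add_zero] at h3
  have h1 := Submodule.finrank_add_le_finrank_add_finrank P Q
  rw [htop, finrank_top, Module.finrank_fintype_fun_eq_card] at h1
  exact h1.trans (Nat.add_le_add_left (finrank_range_le_card _) _)

theorem connected_of_card_le_rank {W : Type*} [Fintype W] [Nonempty W] (F : SimpleGraph W)
    (h : Fintype.card W ≤
      Module.finrank (ZMod 2) (Submodule.span (ZMod 2) (incVec W '' F.edgeSet)) + 1) :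
    F.Connected := by
  by_contra hF
  have : ∃ u v, ¬ F.Reachable u v := by
    by_contra hno
    push Not at hno
    exact hF ⟨hno⟩
  obtain ⟨u, v, huv⟩ := this
  let χ (p : W → Prop) : (W → ZMod 2) →ₗ[ZMod 2] ZMod 2 :=
    ∑ w with p w, LinearMap.proj w
  have χs : ∀ p a, χ p (Pi.single a 1) = if p a then 1 else 0 := by
    intro p a
    simp [χ, Pi.single_apply]
  let L := (χ (F.Reachable u)).prod (χ fun w => ¬ F.Reachable u w)
  have hsurj : Function.Surjective L := by
    rintro ⟨x, y⟩
    refine ⟨x • Pi.single u 1 + y • Pi.single v 1, ?_⟩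
    simp [L, χs, huv]
  have hker : Submodule.span (ZMod 2) (incVec W '' F.edgeSet) ≤ LinearMap.ker L := by
    rw [Submodule.span_le]
    rintro _ ⟨e, he, rfl⟩
    induction e with
    | _ a b =>
      have hab : F.Reachable u a ↔ F.Reachable u b :=
        ⟨fun h => h.trans (SimpleGraph.Adj.reachable he),
          fun h => h.trans (SimpleGraph.Adj.reachable he).symm⟩
      by_cases hb : F.Reachable u b <;>
        simp [incVec_mk, L, χs, hab, hb, CharTwo.add_self_eq_zero]
  have h1 := Submodule.finrank_mono hker
  have h2 := LinearMap.finrank_range_add_finrank_ker L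
  rw [LinearMap.range_eq_top.2 hsurj, finrank_top, Module.finrank_fintype_fun_eq_card,
    Module.finrank_prod, Module.finrank_self] at h2
  omega

/-- The edges of `G` joining different connected components of `H`. -/
noncomputable def crossingEdges {W : Type*} [Fintype W] (G H : SimpleGraph W) :
    Finset (Sym2 W) :=
  G.edgeFinset.filter fun e => ∃ a b, e = s(a, b) ∧ ¬ H.Reachable a b

theorem mem_crossingEdges {W : Type*} [Fintype W] {G H : SimpleGraph W} {e : Sym2 W} :
    e ∈ crossingEdges G H ↔ e ∈ G.edgeSet ∧ ∃ a b, e = s(a, b) ∧ ¬ H.Reachable a b := by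
  rw [crossingEdges, Finset.mem_filter, SimpleGraph.mem_edgeFinset]

theorem exists_rainbow_connected {W : Type*} [Fintype W] [Nonempty W] (G : SimpleGraph W)
    (c : Sym2 W → ℕ)
    (h : ∀ H : SimpleGraph W, Fintype.card H.ConnectedComponent ≤
      ((crossingEdges G H).image c).card + 1) :
    ∃ H ≤ G, H.Connected ∧ IsRainbow c H.edgeSet := by
  set D := G.edgeFinset.image c with hD
  have hDN : Fintype.card W ≤ D.card + 1 := by
    obtain ⟨H, hH⟩ : ∃ H : SimpleGraph W, H = ⊥ := ⟨_, rfl⟩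
    have h1 := h H
    have h2 : Fintype.card W ≤ Fintype.card H.ConnectedComponent := by
      refine Fintype.card_le_of_injective (SimpleGraph.connectedComponentMk _) fun a b hab => ?_
      simpa [hH] using SimpleGraph.ConnectedComponent.exact hab
    have h3 : ((crossingEdges G H).image c).card ≤ D.card :=
      Finset.card_le_card (Finset.image_subset_image fun e he =>
        SimpleGraph.mem_edgeFinset.2 (mem_crossingEdges.1 he).1)
    exact (h2.trans h1).trans (Nat.add_le_add_right h3 1)
  obtain ⟨B, hBS, hBc, hB⟩ := exists_rainbow_subset_rank (K := ZMod 2) (incVec W) c D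
    (D.card + 1 - Fintype.card W) G.edgeFinset (by
      intro J hJ
      set F := SimpleGraph.fromEdgeSet {e | e ∈ G.edgeFinset ∧ c e ∈ J} with hF
      have hFe : F.edgeSet = {e | e ∈ G.edgeFinset ∧ c e ∈ J} := by
        rw [hF, SimpleGraph.edgeSet_fromEdgeSet, sdiff_eq_left, Set.disjoint_left]
        rintro e ⟨he, -⟩
        exact G.not_isDiag_of_mem_edgeSet (SimpleGraph.mem_edgeFinset.1 he)
      rw [← hFe]
      have h1 := card_le_rank_add_card_component F
      have h2 : ((crossingEdges G F).image c).card ≤ (D \ J).card := by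
        refine Finset.card_le_card fun x hx => ?_
        obtain ⟨e, he, rfl⟩ := Finset.mem_image.1 hx
        obtain ⟨heG, a, b, rfl, hab⟩ := mem_crossingEdges.1 he
        refine Finset.mem_sdiff.2
          ⟨Finset.mem_image_of_mem _ (SimpleGraph.mem_edgeFinset.2 heG), fun hxJ => hab ?_⟩
        refine SimpleGraph.Adj.reachable ?_
        rw [← SimpleGraph.mem_edgeSet, hFe]
        exact ⟨SimpleGraph.mem_edgeFinset.2 heG, hxJ⟩
      have h3 := Finset.card_sdiff_add_card_eq_card hJ
      have h4 := h F
      omega)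
  have hBe : (SimpleGraph.fromEdgeSet (B : Set (Sym2 W))).edgeSet = B := by
    rw [SimpleGraph.edgeSet_fromEdgeSet, sdiff_eq_left, Set.disjoint_left]
    intro e he
    exact G.not_isDiag_of_mem_edgeSet (SimpleGraph.mem_edgeFinset.1 (hBS he))
  refine ⟨SimpleGraph.fromEdgeSet B, ?_, connected_of_card_le_rank _ ?_, ?_⟩
  · rw [← SimpleGraph.edgeSet_subset_edgeSet, hBe]
    exact fun e he => SimpleGraph.mem_edgeFinset.1 (hBS he)
  · rw [hBe]; omega
  · rw [hBe]; exact hBc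

theorem card_matching_add_card_component_le {W : Type*} [Fintype W] [Nonempty W]
    (H : SimpleGraph W)
    (M : Finset (Sym2 W)) (hM : IsMatchingSet M)
    (hin : ∀ a b, s(a, b) ∈ M → H.Reachable a b) :
    M.card + Fintype.card H.ConnectedComponent ≤ Fintype.card W := by
  have hout : ∀ C : H.ConnectedComponent, H.connectedComponentMk C.out = C :=
    fun C => Quot.out_eq C
  have hex : ∀ e ∈ M, ∃ w ∈ e, (H.connectedComponentMk w).out ≠ w := by
    intro e he
    induction e with
    | _ a b =>
      by_contra hno
      push Not at hno
      have h1 := hno a (Sym2.mem_mk_left a b)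
      have h2 := hno b (Sym2.mem_mk_right a b)
      rw [SimpleGraph.ConnectedComponent.sound (hin a b he)] at h1
      exact hM.1 _ he (Sym2.mk_isDiag_iff.2 (h1.symm.trans h2))
  choose! w hwe hw using hex
  have hinj : Set.InjOn w (M : Set (Sym2 W)) := by
    intro e he f hf hef
    by_contra hne
    exact hM.2 e he f hf hne _ (hwe e he) (hef ▸ hwe f hf)
  have hinj' : Function.Injective (fun C : H.ConnectedComponent => C.out) := by
    intro C D hCD
    rw [← hout C, ← hout D]
    exact congrArg _ hCD
  have hdisj : Disjoint (M.image w)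
      (Finset.univ.image fun C : H.ConnectedComponent => C.out) := by
    rw [Finset.disjoint_left]
    rintro x hx hx'
    obtain ⟨e, he, rfl⟩ := Finset.mem_image.1 hx
    obtain ⟨C, -, hC⟩ := Finset.mem_image.1 hx'
    apply hw e he
    rw [← hC, hout]
  have h := Finset.card_le_univ (M.image w ∪
    (Finset.univ.image fun C : H.ConnectedComponent => C.out))
  rwa [Finset.card_union_of_disjoint hdisj, Finset.card_image_of_injOn hinj,
    Finset.card_image_of_injective _ hinj', Finset.card_univ] at h

theorem exists_rainbow_connected_of_rich {W ι : Type*} [Fintype W] [Nonempty W] [Fintype ι]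
    (G : SimpleGraph W) (c : Sym2 W → ℕ) (hc : ProperColoring G c) (t p : ℕ)
    (hpt : p ≤ t) (hpN : 2 * p ≤ Fintype.card W)
    (hdeg : ∀ v, Fintype.card W ≤ G.degree v + p)
    (U : ι → Set ℕ) (hU : ∀ i j, i ≠ j → Disjoint (U i) (U j))
    (hι : Fintype.card W ≤ Fintype.card ι + 1)
    (hrich : ∀ i, ∃ M : Finset (Sym2 W), ↑M ⊆ G.edgeSet ∧ (∀ e ∈ M, c e ∈ U i) ∧
      IsMatchingSet M ∧ t ≤ M.card) :
    ∃ H ≤ G, H.Connected ∧ IsRainbow c H.edgeSet := by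
  refine exists_rainbow_connected G c fun H => ?_
  set s := Fintype.card H.ConnectedComponent with hs
  by_cases hst : Fintype.card W < s + t
  · have hcross : ∀ i, ∃ x ∈ (crossingEdges G H).image c, x ∈ U i := by
      intro i
      obtain ⟨M, hMG, hMU, hM, hMt⟩ := hrich i
      by_contra hno
      push Not at hno
      have := card_matching_add_card_component_le H M hM fun a b hab => by
        by_contra hr
        refine hno (c s(a, b)) (Finset.mem_image_of_mem _ (mem_crossingEdges.2
          ⟨hMG hab, a, b, rfl, hr⟩)) (hMU _ hab)
      omega
    choose x hx hxU using hcross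
    have hxinj : Function.Injective x := by
      intro i j hij
      by_contra hne
      exact Set.disjoint_left.1 (hU i j hne) (hxU i) (hij ▸ hxU j)
    have h1 : Fintype.card ι ≤ ((crossingEdges G H).image c).card := by
      rw [← Finset.card_univ]
      exact Finset.card_le_card_of_injOn x (fun i _ => hx i) hxinj.injOn
    have h2 : s ≤ Fintype.card W :=
      Fintype.card_le_of_surjective H.connectedComponentMk Quot.mk_surjective
    omega
  · let f (C : H.ConnectedComponent) : Finset W :=
      Finset.univ.filter fun w => H.connectedComponentMk w = C
    obtain ⟨C, -, hC⟩ := Finset.exists_min_image Finset.univ (fun C => (f C).card)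
      ⟨H.connectedComponentMk (Classical.arbitrary W), Finset.mem_univ _⟩
    have hsum : Fintype.card W = ∑ C, (f C).card := by
      rw [← Finset.card_univ]
      exact Finset.card_eq_sum_card_fiberwise fun _ _ => Finset.mem_coe.2 (Finset.mem_univ _)
    have hmul : s * (f C).card ≤ Fintype.card W := by
      rw [hsum, hs, ← Finset.card_univ, ← smul_eq_mul]
      exact Finset.card_nsmul_le_sum _ _ _ fun D hD => hC D hD
    obtain ⟨v, hv⟩ := Quot.exists_rep C
    have hvC : v ∈ f C := Finset.mem_filter.2 ⟨Finset.mem_univ _, hv⟩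
    have hcross : (G.neighborFinset v \ (f C).erase v).card ≤
        ((crossingEdges G H).image c).card := by
      refine Finset.card_le_card_of_injOn (fun w => c s(v, w)) ?_ ?_
      · intro w hw
        simp only [Finset.coe_sdiff, Set.mem_sdiff, Finset.mem_coe,
          SimpleGraph.mem_neighborFinset, Finset.mem_erase] at hw
        refine Finset.mem_coe.2 (Finset.mem_image_of_mem _ (mem_crossingEdges.2
          ⟨hw.1, v, w, rfl, fun hr => hw.2 ⟨hw.1.ne', ?_⟩⟩))
        exact Finset.mem_filter.2 ⟨Finset.mem_univ _,
          (SimpleGraph.ConnectedComponent.sound hr).symm.trans hv⟩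
      · intro w hw w' hw' hww
        by_contra hne
        simp only [Finset.coe_sdiff, Set.mem_sdiff, Finset.mem_coe,
          SimpleGraph.mem_neighborFinset] at hw hw'
        exact hc hw.1 hw'.1 hne hww
    have h1 := Finset.le_card_sdiff ((f C).erase v) (G.neighborFinset v)
    rw [SimpleGraph.card_neighborFinset_eq_degree, Finset.card_erase_of_mem hvC] at h1
    have h2 := hdeg v
    have h3 : 0 < (f C).card := Finset.card_pos.2 ⟨v, hvC⟩
    obtain hs1 | hs2 : s ≤ 1 ∨ 2 ≤ s := by omega
    · omega
    obtain ha | ha : (f C).card = 1 ∨ 2 ≤ (f C).card := by omega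
    · omega
    · have : 2 * s + 2 * (f C).card ≤ s * (f C).card + 4 := by nlinarith
      omega

theorem RobustlyColoured.wellColoured {V ι : Type*} [Fintype V] [Fintype ι] {G : SimpleGraph V}
    {c : Sym2 V → ℕ} {α : ℝ} {t : ℕ} (h : RobustlyColoured G c α t)
    (hι : Fintype.card ι ≤ t) (F : ι → SimpleGraph V) (hF : ∀ i, RainbowForest G c (F i)) :
    WellColoured (G.deleteEdges (⋃ i, (F i).edgeSet)) c α := by
  obtain ⟨e⟩ : Nonempty (ι ↪ Fin t) :=
    Function.Embedding.nonempty_of_card_le (by simpa using hι)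
  have hbot : RainbowForest G c ⊥ :=
    ⟨bot_le, SimpleGraph.isAcyclic_bot, by simp [IsRainbow]⟩
  have key := h (Function.extend e F fun _ => ⊥) fun x => by
    by_cases hx : ∃ i, e i = x
    · obtain ⟨i, rfl⟩ := hx
      rw [e.injective.extend_apply]
      exact hF i
    · rw [Function.extend_apply' _ _ _ hx]
      exact hbot
  convert key using 2
  ext d
  simp only [Set.mem_iUnion]
  constructor
  · rintro ⟨i, hi⟩
    exact ⟨e i, by rwa [e.injective.extend_apply]⟩
  · rintro ⟨x, hx⟩
    by_cases hx' : ∃ i, e i = x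
    · obtain ⟨i, rfl⟩ := hx'
      rw [e.injective.extend_apply] at hx
      exact ⟨i, hx⟩
    · rw [Function.extend_apply' _ _ _ hx'] at hx
      simp at hx

theorem ProperColoring.isRainbow_starGraph {V : Type*} {c : Sym2 V → ℕ}
    (hc : ProperColoring (⊤ : SimpleGraph V) c) (v : V) :
    IsRainbow c (SimpleGraph.starGraph v).edgeSet := by
  have hform : ∀ e ∈ (SimpleGraph.starGraph v).edgeSet, ∃ w, v ≠ w ∧ e = s(v, w) := by
    intro e he
    induction e with
    | _ a b =>
      rw [SimpleGraph.mem_edgeSet, SimpleGraph.starGraph_adj] at he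
      obtain ⟨hab, rfl | rfl⟩ := he
      · exact ⟨b, hab, rfl⟩
      · exact ⟨a, hab.symm, Sym2.eq_swap⟩
  intro e he e' he' hee
  obtain ⟨w, hw, rfl⟩ := hform e he
  obtain ⟨w', hw', rfl⟩ := hform e' he'
  by_contra hne
  exact hc hw hw' (fun h => hne (by rw [h])) hee

theorem ProperColoring.rainbowForest_starGraph {V : Type*} {c : Sym2 V → ℕ}
    (hc : ProperColoring (⊤ : SimpleGraph V) c) (v : V) :
    RainbowForest ⊤ c (SimpleGraph.starGraph v) :=
  ⟨le_top, SimpleGraph.isAcyclic_starGraph v, hc.isRainbow_starGraph v⟩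

/-- The sum of the degrees of `v` in the first `j` graphs of the sequence `T`. -/
noncomputable def degSum {V : Type*} [Fintype V] (T : ℕ → SimpleGraph V) (j : ℕ) (v : V) : ℕ :=
  ∑ i ∈ Finset.range j, (T i).degree v

theorem card_adj_le_degSum {V : Type*} [Fintype V] (T : ℕ → SimpleGraph V) (j : ℕ) (v : V) :
    (Finset.univ.filter fun w => ∃ i < j, (T i).Adj v w).card ≤ degSum T j v := by
  have : (Finset.univ.filter fun w => ∃ i < j, (T i).Adj v w) ⊆
      (Finset.range j).biUnion fun i => (T i).neighborFinset v := by
    intro w hw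
    obtain ⟨i, hi, hiw⟩ := (Finset.mem_filter.1 hw).2
    exact Finset.mem_biUnion.2 ⟨i, Finset.mem_range.2 hi, by simpa using hiw⟩
  refine (Finset.card_le_card this).trans (Finset.card_biUnion_le.trans ?_)
  simp [degSum]

/-- The graph induced on the complement of `Z`, without the colours in `Q` and the edges of the
first `j` graphs of the sequence `T`. -/
def remainingGraph {V : Type*} (c : Sym2 V → ℕ) (T : ℕ → SimpleGraph V) (j : ℕ)
    (Z : Finset V) (Q : Finset ℕ) : SimpleGraph {v // v ∉ Z} where
  Adj a b := a ≠ b ∧ c s(a.1, b.1) ∉ Q ∧ ∀ i < j, ¬ (T i).Adj a.1 b.1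
  symm := ⟨fun a b h => ⟨h.1.symm, by rw [Sym2.eq_swap]; exact h.2.1,
    fun i hi hi' => h.2.2 i hi hi'.symm⟩⟩
  loopless := ⟨fun a h => h.1 rfl⟩

theorem card_le_degree_remainingGraph {V : Type*} [Fintype V] {c : Sym2 V → ℕ}
    (hc : ProperColoring (⊤ : SimpleGraph V) c) (T : ℕ → SimpleGraph V) (j : ℕ)
    (Z : Finset V) (Q : Finset ℕ) (v : {v // v ∉ Z}) :
    Fintype.card {v // v ∉ Z} ≤
      (remainingGraph c T j Z Q).degree v + (1 + Q.card + degSum T j v) := by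
  set N := (remainingGraph c T j Z Q).neighborFinset v with hN
  set A := Finset.univ.filter fun w : {v // v ∉ Z} => w ≠ v ∧ c s(v.1, w.1) ∈ Q with hA
  set B := Finset.univ.filter fun w : {v // v ∉ Z} => ∃ i < j, (T i).Adj v.1 w.1 with hB
  have hAc : A.card ≤ Q.card := by
    refine Finset.card_le_card_of_injOn (fun w => c s(v.1, w.1)) ?_ ?_
    · intro w hw
      exact (Finset.mem_filter.1 hw).2.2
    · intro w hw w' hw' hww
      by_contra hne
      have h1 := (Finset.mem_filter.1 hw).2.1
      have h2 := (Finset.mem_filter.1 hw').2.1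
      exact hc (a := v.1) (b := w.1) (b' := w'.1) (fun h => h1 (Subtype.ext h.symm))
        (fun h => h2 (Subtype.ext h.symm)) (fun h => hne (Subtype.ext h)) hww
  have hBc : B.card ≤ degSum T j v := by
    refine le_trans ?_ (card_adj_le_degSum T j v)
    refine Finset.card_le_card_of_injOn Subtype.val ?_ Subtype.val_injective.injOn
    intro w hw
    exact Finset.mem_coe.2 (Finset.mem_filter.2 ⟨Finset.mem_univ _, (Finset.mem_filter.1 hw).2⟩)
  have hcov : (Finset.univ : Finset {v // v ∉ Z}) ⊆ N ∪ (({v} ∪ A) ∪ B) := by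
    intro w _
    by_cases h1 : w = v
    · simp [h1]
    by_cases h2 : c s(v.1, w.1) ∈ Q
    · simp [hA, h1, h2]
    by_cases h3 : ∃ i < j, (T i).Adj v.1 w.1
    · exact Finset.mem_union_right _ (Finset.mem_union_right _
        (Finset.mem_filter.2 ⟨Finset.mem_univ _, h3⟩))
    · refine Finset.mem_union_left _ ?_
      rw [hN, SimpleGraph.mem_neighborFinset]
      push Not at h3
      exact ⟨fun h => h1 h.symm, h2, h3⟩
  have h1 := Finset.card_le_card hcov
  have h2 := Finset.card_union_le N (({v} ∪ A) ∪ B)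
  have h3 := Finset.card_union_le ({v} ∪ A) B
  have h4 := Finset.card_union_le {v} A
  rw [Finset.card_singleton] at h4
  rw [Finset.card_univ] at h1
  have h5 : N.card = (remainingGraph c T j Z Q).degree v :=
    SimpleGraph.card_neighborFinset_eq_degree _ _
  omega

theorem exists_rainbow_connected_remainingGraph {V : Type*} [Fintype V] {c : Sym2 V → ℕ}
    {β : ℝ} {t : ℕ} (ht : (t : ℝ) ≤ β * Fintype.card V)
    (hc : ProperColoring (⊤ : SimpleGraph V) c)
    (hrobust : RobustlyColoured (⊤ : SimpleGraph V) c β t)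
    (T : ℕ → SimpleGraph V) (j D : ℕ) (Z : Finset V) (Q : Finset ℕ)
    (hT : ∀ i < j, (T i).IsAcyclic ∧ IsRainbow c (T i).edgeSet) (hQ : Q.card ≤ Z.card)
    (hjt : j + Z.card ≤ t) (hD : ∀ v ∉ Z, degSum T j v < D) (hDt : D + Z.card ≤ t)
    (hZ : 2 * D + 3 * Z.card < Fintype.card V) :
    ∃ H ≤ remainingGraph c T j Z Q, H.Connected ∧
      IsRainbow (fun e => c (e.map Subtype.val)) H.edgeSet := by
  have hW : Fintype.card {v // v ∉ Z} + Z.card = Fintype.card V := by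
    have := Fintype.card_subtype_compl (fun v => v ∈ Z)
    rw [Fintype.card_coe] at this
    have h2 := Finset.card_le_univ Z
    omega
  have : Nonempty {v // v ∉ Z} := Fintype.card_pos_iff.1 (by omega)
  obtain ⟨U, hUd, hUr, -⟩ := hrobust.wellColoured (ι := Fin j ⊕ {v // v ∈ Z})
    (by simpa using hjt) (Sum.elim (fun i => T i) fun z => SimpleGraph.starGraph z.1) (by
      rintro (i | z)
      · exact ⟨le_top, hT i i.2⟩
      · exact hc.rainbowForest_starGraph _)
  have hcardU : Fintype.card V - 1 ≤
      Fintype.card {i : Fin (Fintype.card V - 1) // ∀ x ∈ Q, x ∉ U i} + Q.card := by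
    have h1 : (Finset.univ.filter fun i => ¬ ∀ x ∈ Q, x ∉ U i).card ≤ Q.card := by
      have hex : ∀ i : Fin (Fintype.card V - 1), (¬ ∀ x ∈ Q, x ∉ U i) → ∃ x ∈ Q, x ∈ U i := by
        intro i hi
        push Not at hi
        exact hi
      choose! x hxQ hxU using hex
      refine Finset.card_le_card_of_injOn x (fun i hi => hxQ i (Finset.mem_filter.1 hi).2) ?_
      intro i hi i' hi' hii
      by_contra hne
      exact Set.disjoint_left.1 (hUd i i' hne) (hxU i (Finset.mem_filter.1 hi).2)
        (hii ▸ hxU i' (Finset.mem_filter.1 hi').2)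
    have h2 := Finset.card_filter_add_card_filter_not (s := Finset.univ)
      (fun i : Fin (Fintype.card V - 1) => ∀ x ∈ Q, x ∉ U i)
    rw [Finset.card_univ, Fintype.card_fin] at h2
    rw [Fintype.card_subtype]
    omega
  refine exists_rainbow_connected_of_rich (remainingGraph c T j Z Q) _ ?_ t (D + Z.card) hDt
    (by omega) ?_ (fun i : {i : Fin (Fintype.card V - 1) // ∀ x ∈ Q, x ∉ U i} => U i.1) ?_
    (by omega) ?_
  · intro a b b' hab hab' hbb
    exact hc (a := a.1) (b := b.1) (b' := b'.1) (fun h => hab.1 (Subtype.ext h))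
      (fun h => hab'.1 (Subtype.ext h)) (fun h => hbb (Subtype.ext h))
  · intro v
    have h1 := card_le_degree_remainingGraph hc T j Z Q v
    have h2 := hD v v.2
    omega
  · intro i i' hii
    exact hUd _ _ fun h => hii (Subtype.ext h)
  · rintro ⟨i, hi⟩
    obtain ⟨M, hMG, hMU, hM, hMc⟩ := hUr i
    have hMadj : ∀ a b, s(a, b) ∈ M → a ≠ b ∧ a ∉ Z ∧ b ∉ Z ∧ ∀ i < j, ¬ (T i).Adj a b := by
      intro a b hab
      have h1 := hMG hab
      rw [SimpleGraph.mem_edgeSet, SimpleGraph.deleteEdges_adj, SimpleGraph.top_adj] at h1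
      obtain ⟨hne, h1⟩ := h1
      simp only [Set.mem_iUnion, not_exists, Sum.forall, Sum.elim_inl, Sum.elim_inr,
        SimpleGraph.mem_edgeSet, SimpleGraph.starGraph_adj] at h1
      refine ⟨hne, fun ha => h1.2 ⟨a, ha⟩ ⟨hne, Or.inl rfl⟩,
        fun hb => h1.2 ⟨b, hb⟩ ⟨hne, Or.inr rfl⟩, fun i hi => h1.1 ⟨i, hi⟩⟩
    refine ⟨Finset.univ.filter fun e => e.map Subtype.val ∈ M, ?_, ?_, ⟨?_, ?_⟩, ?_⟩
    · intro e he
      have he := (Finset.mem_filter.1 he).2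
      induction e with
      | _ a b =>
        have h1 := hMadj _ _ he
        exact ⟨fun h => h1.1 (congrArg _ h), fun h => hi _ h (hMU _ he), h1.2.2.2⟩
    · intro e he
      exact hMU _ (Finset.mem_filter.1 he).2
    · intro e he hd
      have he := (Finset.mem_filter.1 he).2
      induction e with
      | _ a b =>
        exact (hMadj _ _ he).1 (congrArg Subtype.val (Sym2.mk_isDiag_iff.1 hd))
    · intro e he f hf hef v hve hvf
      refine hM.2 _ (Finset.mem_filter.1 he).2 _ (Finset.mem_filter.1 hf).2
        (fun h => hef (Sym2.map.injective Subtype.val_injective h)) v.1 ?_ ?_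
      · exact Sym2.mem_map.2 ⟨v, hve, rfl⟩
      · exact Sym2.mem_map.2 ⟨v, hvf, rfl⟩
    · have h1 : t ≤ M.card := by exact_mod_cast ht.trans hMc
      refine h1.trans ?_
      refine le_trans (Finset.card_le_card (t := (Finset.univ.filter
        fun e : Sym2 {v // v ∉ Z} => e.map Subtype.val ∈ M).image (Sym2.map Subtype.val)) ?_)
        Finset.card_image_le
      intro e he
      induction e with
      | _ a b =>
        have h2 := hMadj a b he
        exact Finset.mem_image.2 ⟨s(⟨a, h2.2.1⟩, ⟨b, h2.2.2.1⟩),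
          Finset.mem_filter.2 ⟨Finset.mem_univ _, he⟩, rfl⟩

theorem exists_greedy_choice {X Y : Type*} [Nonempty Y] (R : X → Y → X → Y → Prop)
    (hsymm : ∀ x y x' y', R x y x' y' → R x' y' x y) (p : ℕ) (O : X → Finset Y) (s : Finset X)
    (hR : ∀ x ∈ s, ∀ x' ∈ s, x ≠ x' → ∀ y',
      ((O x).filter fun y => R x y x' y').card ≤ p)
    (hO : ∀ x ∈ s, p * s.card < (O x).card) :
    ∃ f : X → Y, (∀ x ∈ s, f x ∈ O x) ∧
      ∀ x ∈ s, ∀ x' ∈ s, x ≠ x' → ¬ R x (f x) x' (f x') := by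
  induction s using Finset.induction_on with
  | empty => exact ⟨fun _ => Classical.arbitrary Y, by simp, by simp⟩
  | insert a s ha ih =>
    rw [Finset.card_insert_of_notMem ha] at hO
    obtain ⟨f, hfO, hfR⟩ := ih
      (fun x hx x' hx' => hR x (Finset.mem_insert_of_mem hx) x' (Finset.mem_insert_of_mem hx'))
      (fun x hx => (Nat.mul_le_mul_left p (Nat.le_succ _)).trans_lt
        (hO x (Finset.mem_insert_of_mem hx)))
    obtain ⟨y, hyO, hy⟩ : ∃ y ∈ O a, y ∉ s.biUnion fun x' =>
        (O a).filter fun y => R a y x' (f x') := by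
      refine Finset.exists_mem_notMem_of_card_lt_card (lt_of_le_of_lt ?_
        (hO a (Finset.mem_insert_self _ _)))
      refine (Finset.card_biUnion_le_card_mul _ _ p fun x' hx' => ?_).trans ?_
      · exact hR a (Finset.mem_insert_self _ _) x' (Finset.mem_insert_of_mem hx')
          (fun h => ha (h ▸ hx')) _
      · rw [mul_comm]
        exact Nat.mul_le_mul_left p (Nat.le_succ _)
    have hyR : ∀ x ∈ s, ¬ R a y x (f x) := fun x hx hr =>
      hy (Finset.mem_biUnion.2 ⟨x, hx, Finset.mem_filter.2 ⟨hyO, hr⟩⟩)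
    have hne : ∀ x ∈ s, x ≠ a := fun x hx h => ha (h ▸ hx)
    refine ⟨Function.update f a y, ?_, ?_⟩
    · intro x hx
      obtain rfl | hx := Finset.mem_insert.1 hx
      · rwa [Function.update_self]
      · rw [Function.update_of_ne (hne x hx)]
        exact hfO x hx
    · intro x hx x' hx' hxx
      obtain hxa | hx := Finset.mem_insert.1 hx <;>
        obtain hxa' | hx' := Finset.mem_insert.1 hx'
      · exact absurd (hxa.trans hxa'.symm) hxx
      · rw [hxa, Function.update_self, Function.update_of_ne (hne x' hx')]
        exact hyR x' hx'
      · rw [hxa', Function.update_self, Function.update_of_ne (hne x hx)]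
        exact fun h => hyR x hx (hsymm _ _ _ _ h)
      · rw [Function.update_of_ne (hne x hx), Function.update_of_ne (hne x' hx')]
        exact hfR x hx x' hx' hxx

theorem ProperColoring.card_filter_color_le_one {V : Type*} {c : Sym2 V → ℕ}
    (hc : ProperColoring (⊤ : SimpleGraph V) c) (v : V) (O : Finset V) (hv : v ∉ O) (x : ℕ) :
    (O.filter fun w => c s(v, w) = x).card ≤ 1 := by
  refine Finset.card_le_one.2 fun w hw w' hw' => ?_
  obtain ⟨hw, hwx⟩ := Finset.mem_filter.1 hw
  obtain ⟨hw', hwx'⟩ := Finset.mem_filter.1 hw'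
  by_contra hne
  exact hc (a := v) (b := w) (b' := w') (fun h => hv (h ▸ hw)) (fun h => hv (h ▸ hw')) hne
    (hwx.trans hwx'.symm)

theorem exists_rainbow_attachment {V : Type*} [Fintype V] [Nonempty V] {c : Sym2 V → ℕ}
    (hc : ProperColoring (⊤ : SimpleGraph V) c) (A : V → V → Prop) (S B : Finset V)
    (hSB : Disjoint S B) (k : ℕ)
    (hB : ∀ v ∈ B, (S.filter fun w => A v w).card ≤ k)
    (hS : ∀ v ∈ S, (((S ∪ B)ᶜ).filter fun w => A v w).card ≤ k)
    (hkS : k + 2 * B.card < S.card) (hkV : k + 3 * S.card + 2 * B.card < Fintype.card V) :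
    ∃ f : V → V, (∀ v ∈ B, f v ∈ S) ∧ (∀ v ∈ S, f v ∉ S ∪ B) ∧ Set.InjOn f S ∧
      Set.InjOn (fun v => c s(v, f v)) (S ∪ B : Finset V) ∧
      ∀ v ∈ S ∪ B, ¬ A v (f v) := by
  obtain ⟨f, hfO, hfR⟩ := exists_greedy_choice
    (fun v w v' w' => c s(v, w) = c s(v', w')) (fun _ _ _ _ h => h.symm) 1
    (fun v => S.filter fun w => ¬ A v w) B
    (fun v hv v' hv' hvv w' => by
      convert hc.card_filter_color_le_one v (S.filter fun w => ¬ A v w)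
        (fun h => Finset.disjoint_left.1 hSB (Finset.mem_filter.1 h).1 hv) (c s(v', w')))
    (fun v hv => by
      have h1 := Finset.card_filter_add_card_filter_not (s := S) (fun w => A v w)
      have h2 := hB v hv
      omega)
  set P := B.image fun v => c s(v, f v) with hP
  have hPc : P.card ≤ B.card := Finset.card_image_le
  obtain ⟨g, hgO, hgR⟩ := exists_greedy_choice
    (fun v w v' w' => w = w' ∨ c s(v, w) = c s(v', w'))
    (fun _ _ _ _ h => h.imp Eq.symm Eq.symm) 2
    (fun v => ((S ∪ B)ᶜ).filter fun w => ¬ A v w ∧ c s(v, w) ∉ P) S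
    (fun v hv v' hv' hvv w' => by
      set O := ((S ∪ B)ᶜ).filter fun w => ¬ A v w ∧ c s(v, w) ∉ P with hO
      have h1 := hc.card_filter_color_le_one v O (fun h => Finset.mem_compl.1
        (Finset.mem_filter.1 h).1 (Finset.mem_union_left _ hv)) (c s(v', w'))
      refine (Finset.card_le_card (t := {w'} ∪ O.filter fun w => c s(v, w) = c s(v', w'))
        fun w hw => ?_).trans ((Finset.card_union_le _ _).trans
          (Nat.add_le_add (Finset.card_singleton w').le h1))
      obtain ⟨hwO, h | h⟩ := (@Finset.mem_filter _ _ (_) _ _).1 hw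
      · exact Finset.mem_union_left _ (Finset.mem_singleton.2 h)
      · exact Finset.mem_union_right _ (Finset.mem_filter.2 ⟨hwO, h⟩))
    (fun v hv => by
      have h1 : ((S ∪ B)ᶜ) ⊆ (((S ∪ B)ᶜ).filter fun w => ¬ A v w ∧ c s(v, w) ∉ P) ∪
          ((((S ∪ B)ᶜ).filter fun w => A v w) ∪
            P.biUnion fun x => ((S ∪ B)ᶜ).filter fun w => c s(v, w) = x) := by
        intro w hw
        by_cases ha : A v w
        · exact Finset.mem_union_right _ (Finset.mem_union_left _ (Finset.mem_filter.2 ⟨hw, ha⟩))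
        by_cases hx : c s(v, w) ∈ P
        · exact Finset.mem_union_right _ (Finset.mem_union_right _
            (Finset.mem_biUnion.2 ⟨_, hx, Finset.mem_filter.2 ⟨hw, rfl⟩⟩))
        · exact Finset.mem_union_left _ (Finset.mem_filter.2 ⟨hw, ha, hx⟩)
      have h2 : (P.biUnion fun x => ((S ∪ B)ᶜ).filter fun w => c s(v, w) = x).card ≤
          P.card * 1 := Finset.card_biUnion_le_card_mul _ _ _ fun x _ =>
        hc.card_filter_color_le_one v _
          (fun h => Finset.mem_compl.1 h (Finset.mem_union_left _ hv)) _
      have h3 := (Finset.card_le_card h1).trans (Finset.card_union_le _ _)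
      have h4 := Finset.card_union_le (((S ∪ B)ᶜ).filter fun w => A v w)
        (P.biUnion fun x => ((S ∪ B)ᶜ).filter fun w => c s(v, w) = x)
      have h5 := hS v hv
      have h6 := Finset.card_add_card_compl (S ∪ B)
      have h7 := Finset.card_union_le S B
      omega)
  have hSn : ∀ v ∈ B, v ∉ S := fun v hv hv' => Finset.disjoint_left.1 hSB hv' hv
  have hg := fun v hv => Finset.mem_filter.1 (hgO v hv)
  have hfP : ∀ v ∈ B, c s(v, f v) ∈ P := fun v hv =>
    Finset.mem_image_of_mem (fun v => c s(v, f v)) hv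
  refine ⟨fun v => if v ∈ S then g v else f v, ?_, ?_, ?_, ?_, ?_⟩
  · intro v hv
    simp only [if_neg (hSn v hv)]
    exact (Finset.mem_filter.1 (hfO v hv)).1
  · intro v hv
    simp only [if_pos hv]
    exact Finset.mem_compl.1 (hg v hv).1
  · intro v hv v' hv' hvv
    rw [Finset.mem_coe] at hv hv'
    simp only [if_pos hv, if_pos hv'] at hvv
    by_contra hne
    exact hgR v hv v' hv' hne (Or.inl hvv)
  · intro v hv v' hv' hvv
    by_contra hne
    rw [Finset.mem_coe, Finset.mem_union] at hv hv'
    obtain hv | hv := hv <;> obtain hv' | hv' := hv'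
    · simp only [if_pos hv, if_pos hv'] at hvv
      exact hgR v hv v' hv' hne (Or.inr hvv)
    · simp only [if_pos hv, if_neg (hSn v' hv')] at hvv
      exact (hg v hv).2.2 (hvv ▸ hfP v' hv')
    · simp only [if_neg (hSn v hv), if_pos hv'] at hvv
      exact (hg v' hv').2.2 (hvv ▸ hfP v hv)
    · simp only [if_neg (hSn v hv), if_neg (hSn v' hv')] at hvv
      exact hfR v hv v' hv' hne hvv
  · intro v hv
    obtain hv | hv := Finset.mem_union.1 hv
    · simp only [if_pos hv]
      exact (hg v hv).2.1
    · simp only [if_neg (hSn v hv)]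
      exact (Finset.mem_filter.1 (hfO v hv)).2

/-- Given a rainbow connected graph on the complement of `Z` and a way of attaching the vertices
of `Z` to it in at most two steps, there is a rainbow spanning tree. -/
theorem exists_rainbow_tree_of_attachment {V : Type*} {c : Sym2 V → ℕ} (T : ℕ → SimpleGraph V)
    (j : ℕ) (S B Z : Finset V) (hZ : Z = S ∪ B) (f : V → V)
    (hfB : ∀ v ∈ B, f v ∈ S) (hfS : ∀ v ∈ S, f v ∉ Z)
    (hfc : Set.InjOn (fun v => c s(v, f v)) Z)
    (hfT : ∀ v ∈ Z, ∀ i < j, ¬ (T i).Adj v (f v))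
    (H : SimpleGraph {v // v ∉ Z})
    (hHle : H ≤ remainingGraph c T j Z (Z.image fun v => c s(v, f v)))
    (hH : H.Connected) (hHc : IsRainbow (fun e => c (e.map Subtype.val)) H.edgeSet) :
    ∃ X : SimpleGraph V, X.IsTree ∧ IsRainbow c X.edgeSet ∧
      (∀ a b, X.Adj a b → ∀ i < j, ¬ (T i).Adj a b) ∧
      ∀ a b, X.Adj a b → (a ∉ Z ∧ b ∉ Z) ∨ (a ∈ Z ∧ b = f a) ∨
        (b ∈ Z ∧ a = f b) := by
  set Y : SimpleGraph V := H.map (Function.Embedding.subtype _) ⊔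
    SimpleGraph.fromRel fun a b => a ∈ Z ∧ b = f a with hY
  have hYadj : ∀ a b, Y.Adj a b → (∃ a' b', H.Adj a' b' ∧ a'.1 = a ∧ b'.1 = b) ∨
      (a ∈ Z ∧ b = f a) ∨ (b ∈ Z ∧ a = f b) := by
    intro a b hab
    rw [hY, SimpleGraph.sup_adj, SimpleGraph.map_adj, SimpleGraph.fromRel_adj] at hab
    exact hab.imp id fun h => h.2
  have hYedge : ∀ e ∈ Y.edgeSet, (∃ e' ∈ H.edgeSet, e'.map Subtype.val = e) ∨
      ∃ a ∈ Z, e = s(a, f a) := by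
    intro e he
    induction e with
    | _ a b =>
      obtain ⟨a', b', h, rfl, rfl⟩ | ⟨ha, rfl⟩ | ⟨hb, rfl⟩ := hYadj a b he
      · exact Or.inl ⟨s(a', b'), h, rfl⟩
      · exact Or.inr ⟨a, ha, rfl⟩
      · exact Or.inr ⟨b, hb, Sym2.eq_swap⟩
  have hHQ : ∀ e ∈ H.edgeSet, c (e.map Subtype.val) ∉ Z.image fun v => c s(v, f v) := by
    intro e he
    induction e with
    | _ a b => exact (hHle he).2.1
  have hYc : IsRainbow c Y.edgeSet := by
    intro e he e' he' hee
    obtain ⟨d, hd, rfl⟩ | ⟨a, ha, rfl⟩ := hYedge e he <;>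
      obtain ⟨d', hd', rfl⟩ | ⟨a', ha', rfl⟩ := hYedge e' he'
    · rw [hHc hd hd' hee]
    · exact absurd (hee ▸ Finset.mem_image_of_mem (fun v => c s(v, f v)) ha') (hHQ d hd)
    · exact absurd (hee ▸ Finset.mem_image_of_mem (fun v => c s(v, f v)) ha) (hHQ d' hd')
    · rw [hfc ha ha' hee]
  have hYconn : Y.Connected := by
    obtain ⟨r⟩ := hH.nonempty
    have hW : ∀ a ∉ Z, Y.Reachable a r := by
      intro a ha
      have h1 := (hH ⟨a, ha⟩ r).map (SimpleGraph.Embedding.map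
        (Function.Embedding.subtype fun v => v ∉ Z) H).toHom
      exact h1.mono le_sup_left
    have hf : ∀ a ∈ Z, Y.Reachable a (f a) := by
      intro a ha
      by_cases hne : a = f a
      · rw [← hne]
      · refine SimpleGraph.Adj.reachable (Or.inr ?_)
        rw [SimpleGraph.fromRel_adj]
        exact ⟨hne, Or.inl ⟨ha, rfl⟩⟩
    have hS : ∀ a ∈ S, Y.Reachable a r := fun a ha =>
      (hf a (hZ ▸ Finset.mem_union_left _ ha)).trans (hW _ (hfS a ha))
    have hall : ∀ a, Y.Reachable a r := by
      intro a
      by_cases ha : a ∈ Z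
      · obtain ha' | ha' := Finset.mem_union.1 (hZ ▸ ha)
        · exact hS a ha'
        · exact (hf a ha).trans (hS _ (hfB a ha'))
      · exact hW a ha
    have : Nonempty V := ⟨r.1⟩
    exact ⟨fun a b => (hall a).trans (hall b).symm⟩
  obtain ⟨X, hXY, hX⟩ := hYconn.exists_isTree_le
  refine ⟨X, hX, hYc.mono (SimpleGraph.edgeSet_subset_edgeSet.2 hXY), ?_, ?_⟩
  · intro a b hab i hi
    obtain ⟨a', b', h, rfl, rfl⟩ | ⟨ha, rfl⟩ | ⟨hb, rfl⟩ := hYadj a b (hXY hab)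
    · exact (hHle h).2.2 i hi
    · exact hfT a ha i hi
    · exact fun h => hfT b hb i hi h.symm
  · intro a b hab
    obtain ⟨a', b', h, rfl, rfl⟩ | h := hYadj a b (hXY hab)
    · exact Or.inl ⟨a'.2, b'.2⟩
    · exact Or.inr h

/-- The first `j` graphs of `T` are edge-disjoint rainbow spanning trees that use the edges at `S`
sparingly: every vertex outside `S` has at most one neighbour in `S` in each of them, and every
vertex of `S` has at most one neighbour of small total degree outside `S` in each of them. -/
structure IsSparsePacking {V : Type*} [Fintype V] (c : Sym2 V → ℕ) (S : Finset V) (D : ℕ)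
    (T : ℕ → SimpleGraph V) (j : ℕ) : Prop where
  tree : ∀ i < j, (T i).IsTree
  rainbow : ∀ i < j, IsRainbow c (T i).edgeSet
  disjoint : ∀ i < j, ∀ i' < i, ∀ a b, (T i).Adj a b → ¬ (T i').Adj a b
  outer : ∀ i < j, ∀ v ∉ S, ∀ s ∈ S, ∀ s' ∈ S, (T i).Adj v s → (T i).Adj v s' → s = s'
  inner : ∀ i < j, ∀ s ∈ S, ∀ v ∉ S, ∀ v' ∉ S, degSum T j v < D → degSum T j v' < D →
    (T i).Adj s v → (T i).Adj s v' → v = v'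

theorem degSum_update {V : Type*} [Fintype V] (T : ℕ → SimpleGraph V) (X : SimpleGraph V)
    (j : ℕ) (v : V) : degSum (Function.update T j X) (j + 1) v = degSum T j v + X.degree v := by
  rw [degSum, Finset.sum_range_succ, degSum]
  congr 1
  · refine Finset.sum_congr rfl fun i hi => ?_
    rw [Function.update_of_ne (Finset.mem_range.1 hi).ne]
  · rw [Function.update_self]

theorem sum_degSum_le {V : Type*} [Fintype V] (T : ℕ → SimpleGraph V) (j : ℕ)
    (hT : ∀ i < j, (T i).IsTree) :
    ∑ v, degSum T j v ≤ 2 * j * Fintype.card V := by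
  simp only [degSum]
  rw [Finset.sum_comm]
  have : ∀ i ∈ Finset.range j, ∑ v, (T i).degree v ≤ 2 * Fintype.card V := by
    intro i hi
    rw [SimpleGraph.sum_degrees_eq_twice_card_edges]
    have := (hT i (Finset.mem_range.1 hi)).card_edgeFinset
    omega
  refine (Finset.sum_le_card_nsmul _ _ _ this).trans (le_of_eq ?_)
  rw [Finset.card_range, smul_eq_mul]
  ring

theorem card_filter_exists_lt_le {V : Type*} (A : Finset V) (P : ℕ → V → Prop) (j : ℕ)
    (h : ∀ i < j, ∀ x ∈ A, ∀ y ∈ A, P i x → P i y → x = y) :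
    (A.filter fun x => ∃ i < j, P i x).card ≤ j := by
  have h1 : (A.filter fun x => ∃ i < j, P i x) ⊆
      (Finset.range j).biUnion fun i => A.filter (P i) := by
    intro x hx
    obtain ⟨hxA, i, hi, hix⟩ := Finset.mem_filter.1 hx
    exact Finset.mem_biUnion.2 ⟨i, Finset.mem_range.2 hi, Finset.mem_filter.2 ⟨hxA, hix⟩⟩
  refine (Finset.card_le_card h1).trans ((Finset.card_biUnion_le_card_mul _ _ 1 ?_).trans ?_)
  · intro i hi
    refine Finset.card_le_one.2 fun x hx y hy => ?_
    exact h i (Finset.mem_range.1 hi) x (Finset.mem_filter.1 hx).1 y (Finset.mem_filter.1 hy).1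
      (Finset.mem_filter.1 hx).2 (Finset.mem_filter.1 hy).2
  · simp

theorem IsSparsePacking.exists_succ {V : Type*} [Fintype V] {c : Sym2 V → ℕ} {β : ℝ} {t : ℕ}
    (ht : (t : ℝ) ≤ β * Fintype.card V)
    (hc : ProperColoring (⊤ : SimpleGraph V) c)
    (hrobust : RobustlyColoured (⊤ : SimpleGraph V) c β t)
    {S : Finset V} {D k b j : ℕ} {T : ℕ → SimpleGraph V}
    (hT : IsSparsePacking c S D T j) (hj : j ≤ k)
    (hb : 2 * k * Fintype.card V < (b + 1) * D)
    (hkS : k + 2 * b < S.card) (hkV : k + 3 * S.card + 2 * b < Fintype.card V)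
    (hkt : k + S.card + b ≤ t) (hDt : D + S.card + b ≤ t)
    (hDV : 2 * D + 3 * (S.card + b) < Fintype.card V) :
    ∃ X, IsSparsePacking c S D (Function.update T j X) (j + 1) := by
  set B := Finset.univ.filter fun v => v ∉ S ∧ D ≤ degSum T j v with hB
  have hmemB : ∀ v, v ∈ B ↔ v ∉ S ∧ D ≤ degSum T j v := by simp [hB]
  have hSB : Disjoint S B := Finset.disjoint_left.2 fun v hv hvB => ((hmemB v).1 hvB).1 hv
  have hBc : B.card ≤ b := by
    by_contra hlt
    push Not at hlt
    have h1 : B.card * D ≤ ∑ v ∈ B, degSum T j v := by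
      rw [← smul_eq_mul]
      exact Finset.card_nsmul_le_sum _ _ _ fun v hv => ((hmemB v).1 hv).2
    have h2 : ∑ v ∈ B, degSum T j v ≤ ∑ v, degSum T j v :=
      Finset.sum_le_sum_of_subset (Finset.subset_univ _)
    have h3 := sum_degSum_le T j hT.tree
    have h4 : (b + 1) * D ≤ B.card * D := Nat.mul_le_mul_right _ hlt
    have h5 : 2 * j * Fintype.card V ≤ 2 * k * Fintype.card V := by gcongr
    omega
  have hZc : (S ∪ B).card = S.card + B.card := Finset.card_union_of_disjoint hSB
  have : Nonempty V := Fintype.card_pos_iff.1 (by omega)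
  have hlow : ∀ v ∉ S ∪ B, v ∉ S ∧ degSum T j v < D := by
    intro v hv
    rw [Finset.mem_union, hmemB] at hv
    push Not at hv
    exact ⟨hv.1, hv.2 hv.1⟩
  obtain ⟨f, hfB, hfS, hfinj, hfc, hfT⟩ := exists_rainbow_attachment hc
    (fun v w => ∃ i < j, (T i).Adj v w) S B hSB k
    (fun v hv => by
      have h := card_filter_exists_lt_le S (fun i w => (T i).Adj v w) j
        fun i hi s hs s' hs' => hT.outer i hi v ((hmemB v).1 hv).1 s hs s' hs'
      refine (Finset.card_le_card fun w hw => ?_).trans (h.trans hj)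
      obtain ⟨h1, h2⟩ := (@Finset.mem_filter _ _ (_) _ _).1 hw
      exact (@Finset.mem_filter _ _ (_) _ _).2 ⟨h1, h2⟩)
    (fun s hs => by
      have h := card_filter_exists_lt_le (S ∪ B)ᶜ (fun i w => (T i).Adj s w) j
        fun i hi v hv v' hv' => by
          have h1 := hlow v (Finset.mem_compl.1 hv)
          have h2 := hlow v' (Finset.mem_compl.1 hv')
          exact hT.inner i hi s hs v h1.1 v' h2.1 h1.2 h2.2
      refine (Finset.card_le_card fun w hw => ?_).trans (h.trans hj)
      obtain ⟨h1, h2⟩ := (@Finset.mem_filter _ _ (_) _ _).1 hw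
      exact (@Finset.mem_filter _ _ (_) _ _).2 ⟨h1, h2⟩)
    (by omega) (by omega)
  obtain ⟨H, hHle, hH, hHc⟩ := exists_rainbow_connected_remainingGraph ht hc hrobust T j D (S ∪ B)
    ((S ∪ B).image fun v => c s(v, f v))
    (fun i hi => ⟨(hT.tree i hi).isAcyclic, hT.rainbow i hi⟩) Finset.card_image_le
    (by omega) (fun v hv => (hlow v hv).2) (by omega) (by omega)
  obtain ⟨X, hX, hXc, hXT, hXadj⟩ := exists_rainbow_tree_of_attachment T j S B (S ∪ B) rfl f
    hfB hfS hfc (fun v hv i hi h => hfT v hv ⟨i, hi, h⟩) H hHle hH hHc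
  have hXS : ∀ v ∉ S, ∀ s ∈ S, X.Adj v s → (v ∈ B ∧ s = f v) ∨ (v ∉ S ∪ B ∧ v = f s) := by
    intro v hv s hs hvs
    have hsZ : s ∈ S ∪ B := Finset.mem_union_left _ hs
    obtain h | h | h := hXadj v s hvs
    · exact absurd hsZ h.2
    · exact Or.inl ⟨(Finset.mem_union.1 h.1).resolve_left hv, h.2⟩
    · exact Or.inr ⟨h.2 ▸ hfS s hs, h.2⟩
  have hold : ∀ i < j, Function.update T j X i = T i := fun i hi =>
    Function.update_of_ne hi.ne _ _
  have hmono : ∀ v, degSum (Function.update T j X) (j + 1) v < D → degSum T j v < D := by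
    intro v hv
    rw [degSum_update] at hv
    omega
  refine ⟨X, ⟨?_, ?_, ?_, ?_, ?_⟩⟩
  · intro i hi
    obtain hi | rfl := Nat.lt_succ_iff_lt_or_eq.1 hi
    · rw [hold i hi]; exact hT.tree i hi
    · rwa [Function.update_self]
  · intro i hi
    obtain hi | rfl := Nat.lt_succ_iff_lt_or_eq.1 hi
    · rw [hold i hi]; exact hT.rainbow i hi
    · rwa [Function.update_self]
  · intro i hi i' hi' a b hab
    obtain hi | rfl := Nat.lt_succ_iff_lt_or_eq.1 hi
    · rw [hold i hi] at hab
      rw [hold i' (hi'.trans hi)]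
      exact hT.disjoint i hi i' hi' a b hab
    · rw [Function.update_self] at hab
      rw [hold i' hi']
      exact hXT a b hab i' hi'
  · intro i hi v hv s hs s' hs' h h'
    obtain hi | rfl := Nat.lt_succ_iff_lt_or_eq.1 hi
    · rw [hold i hi] at h h'
      exact hT.outer i hi v hv s hs s' hs' h h'
    · rw [Function.update_self] at h h'
      obtain h | h := hXS v hv s hs h <;> obtain h' | h' := hXS v hv s' hs' h'
      · exact h.2.trans h'.2.symm
      · exact absurd (Finset.mem_union_right _ h.1) h'.1
      · exact absurd (Finset.mem_union_right _ h'.1) h.1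
      · exact hfinj hs hs' (h.2.symm.trans h'.2)
  · intro i hi s hs v hv v' hv' hvD hvD' h h'
    have h1 := hmono v hvD
    have h2 := hmono v' hvD'
    obtain hi | rfl := Nat.lt_succ_iff_lt_or_eq.1 hi
    · rw [hold i hi] at h h'
      exact hT.inner i hi s hs v hv v' hv' h1 h2 h h'
    · rw [Function.update_self] at h h'
      have h3 : ∀ w, degSum T i w < D → w ∉ B := fun w hw hwB =>
        absurd ((hmemB w).1 hwB).2 (not_le.2 hw)
      have h4 := (hXS v hv s hs h.symm).resolve_left fun h => h3 v h1 h.1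
      have h5 := (hXS v' hv' s hs h'.symm).resolve_left fun h => h3 v' h2 h.1
      exact h4.2.trans h5.2.symm

theorem exists_disjoint_rainbow_trees {V : Type*} [Fintype V] {c : Sym2 V → ℕ} {β : ℝ} {t : ℕ}
    (ht : (t : ℝ) ≤ β * Fintype.card V)
    (hc : ProperColoring (⊤ : SimpleGraph V) c)
    (hrobust : RobustlyColoured (⊤ : SimpleGraph V) c β t) (D k b m : ℕ)
    (hb : 2 * k * Fintype.card V < (b + 1) * D)
    (hkS : k + 2 * b < m) (hkV : k + 3 * m + 2 * b < Fintype.card V)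
    (hkt : k + m + b ≤ t) (hDt : D + m + b ≤ t)
    (hDV : 2 * D + 3 * (m + b) < Fintype.card V) :
    ∃ T : Fin k → SimpleGraph V, (∀ i, (T i).IsTree ∧ IsRainbow c (T i).edgeSet) ∧
      ∀ i j, i ≠ j → Disjoint (T i).edgeSet (T j).edgeSet := by
  obtain ⟨S, -, rfl⟩ := Finset.exists_subset_card_eq
    (s := (Finset.univ : Finset V)) (n := m) (by rw [Finset.card_univ]; omega)
  have key : ∀ j ≤ k, ∃ T, IsSparsePacking c S D T j := by
    intro j
    induction j with
    | zero => exact fun _ => ⟨fun _ => ⊥, by constructor <;> simp⟩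
    | succ j ih =>
      intro hj
      obtain ⟨T, hT⟩ := ih (by omega)
      obtain ⟨X, hX⟩ := hT.exists_succ ht hc hrobust (by omega : j ≤ k) hb hkS hkV hkt hDt hDV
      exact ⟨_, hX⟩
  obtain ⟨T, hT⟩ := key k le_rfl
  have hdisj : ∀ i < k, ∀ i' < i, Disjoint (T i).edgeSet (T i').edgeSet := by
    intro i hi i' hi'
    rw [Set.disjoint_left]
    intro e he he'
    induction e with
    | _ a b => exact hT.disjoint i hi i' hi' a b he he'
  refine ⟨fun i => T i, fun i => ⟨hT.tree i i.2, hT.rainbow i i.2⟩, fun i j hij => ?_⟩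
  obtain h | h := lt_or_gt_of_ne (fun h => hij (Fin.ext h) : i.1 ≠ j.1)
  · exact (hdisj j j.2 i h).symm
  · exact hdisj i i.2 j h

theorem stmt4 {V : Type*} [Fintype V] [DecidableEq V] (c : Sym2 V → ℕ)
    (β : ℝ) (hβ : 0 < β) (hβ' : β ≤ 1 / 2)
    (hproper : ProperColoring (⊤ : SimpleGraph V) c)
    (hrobust : RobustlyColoured (⊤ : SimpleGraph V) c β
      ⌊β * (Fintype.card V : ℝ)⌋₊) :
    ∃ (k : ℕ) (T : Fin k → SimpleGraph V),
      β ^ 2 * (Fintype.card V : ℝ) / 2500 ≤ (k : ℝ) ∧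
      (∀ i, (T i).IsTree ∧ IsRainbow c (T i).edgeSet) ∧
      (∀ i j, i ≠ j → Disjoint ((T i).edgeSet) ((T j).edgeSet)) := by
  obtain hV | hV := isEmpty_or_nonempty V
  · exact ⟨0, fun i => i.elim0, by simp, fun i => i.elim0, fun i => i.elim0⟩
  obtain hsmall | hlarge := le_or_gt (β ^ 2 * (Fintype.card V : ℝ) / 2500) 1
  · obtain ⟨v⟩ := hV
    refine ⟨1, fun _ => SimpleGraph.starGraph v, by simpa using hsmall, fun _ =>
      ⟨SimpleGraph.isTree_starGraph v, hproper.isRainbow_starGraph v⟩, fun i j hij => ?_⟩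
    exact absurd (Subsingleton.elim i j) hij
  set n : ℝ := (Fintype.card V : ℝ) with hn
  set x := β ^ 2 * n / 2500 with hx
  have hn0 : 0 ≤ n := Nat.cast_nonneg _
  have hβn : β * (β * n) ≤ 1 / 2 * (β * n) := by gcongr
  have hβn' : β * n ≤ 1 / 2 * n := by gcongr
  have hxβ : x = β * (β * n) / 2500 := by rw [hx]; ring
  have ht := Nat.floor_le (show 0 ≤ β * n by positivity)
  have ht' := Nat.lt_floor_add_one (β * n)
  have hk := Nat.le_ceil x
  have hk' := Nat.ceil_lt_add_one (show 0 ≤ x by positivity)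
  have hD := Nat.le_ceil (β * n / 4)
  have hD' := Nat.ceil_lt_add_one (show 0 ≤ β * n / 4 by positivity)
  have hb := Nat.floor_le (show 0 ≤ 8 * (⌈x⌉₊ : ℝ) / β by positivity)
  have hb' := Nat.lt_floor_add_one (8 * (⌈x⌉₊ : ℝ) / β)
  have hbu : 8 * (⌈x⌉₊ : ℝ) / β ≤ 16 * (β * n) / 2500 := by
    rw [div_le_iff₀ hβ]
    have : (⌈x⌉₊ : ℝ) ≤ 2 * x := by linarith
    rw [hxβ] at this
    nlinarith
  set k := ⌈x⌉₊ with hkdef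
  set b := ⌊8 * (k : ℝ) / β⌋₊ with hbdef
  set D := ⌈β * n / 4⌉₊ with hDdef
  set t := ⌊β * n⌋₊ with htdef
  obtain ⟨T, hT⟩ := exists_disjoint_rainbow_trees ht hproper hrobust D k b (k + 2 * b + 1)
    (by
      have h1 : 2 * (k : ℝ) * n ≤ (8 * (k : ℝ) / β) * (β * n / 4) := by
        apply le_of_eq
        field_simp
        ring
      have h2 : (8 * (k : ℝ) / β) * (β * n / 4) < ((b : ℝ) + 1) * D := by
        have : 0 < β * n / 4 := by linarith
        calc (8 * (k : ℝ) / β) * (β * n / 4) < ((b : ℝ) + 1) * (β * n / 4) := by gcongr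
          _ ≤ _ := by gcongr
      have h3 := h1.trans_lt h2
      rw [hn] at h3
      exact_mod_cast h3)
    (by omega)
    (by
      have : (k : ℝ) + 3 * (k + 2 * b + 1) + 2 * b < n := by linarith
      rw [hn] at this
      exact_mod_cast this)
    (by
      have : (k : ℝ) + (k + 2 * b + 1) + b < t + 1 := by linarith
      exact Nat.lt_succ_iff.1 (by exact_mod_cast this))
    (by
      have : (D : ℝ) + (k + 2 * b + 1) + b < t + 1 := by linarith
      exact Nat.lt_succ_iff.1 (by exact_mod_cast this))
    (by
      have : 2 * (D : ℝ) + 3 * ((k + 2 * b + 1) + b) < n := by linarith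
      rw [hn] at this
      exact_mod_cast this)
  exact ⟨k, T, hk, hT⟩
end
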